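/- Let λ : ℕ → [0,∞) be a sequence, let m : [0,∞) → [0,∞) satisfy m(x) ≥ μ₁ > 0 for every x ≥ 0 and |m(a) − m(b)| ≤ ω_m(|a−b|) for all a,b ≥ 0, where ω_m is a continuity modulus. Let σ ∈ (0,1/2] and δ > 0, and let α ∈ [0,1/4) satisfy limsup_{x→0⁺} (ω_m(x))^{4α} / x^{1−2σ} < +∞. Let ω_d be a continuity modulus with ω_d(1) = 1, ω_d(x) ≤ x^{4α} for every x ≥ 0, and lim_{x→0⁺} ω_d(x)/x^{4α} = 0. Then every solution u on an interval [0,T] of the Kirchhoff equation u'' + 2δ A^σ u' + m(|A^{1/2}u|²) A u = 0 with initial data (u⁰,u¹) ∈ V_{ω_d}, which satisfies (u(t),u'(t)) ∈ V_{ω_d} with continuity of the curves t ↦ ((ω_d(1/λ_k))^{−1/2} λ_k u_k(t))_{k : λ_k>0} and t ↦ ((ω_d(1/λ_k))^{−1/2} u_k'(t))_{k : λ_k>0} in ℓ², can be continued to a solution with the same regularity on a maximal time-interval [0,T*) with T* ≥ T, and either T* = +∞ or limsup_{t→T*⁻} ‖(u(t),u'(t))‖_{ω_d} = +∞. -/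

import Mathlib

open Set Filter MeasureTheory Topology

noncomputable section

/-- A continuity modulus: continuous on `[0,∞)`, vanishing at `0`, positive for positive
arguments, nondecreasing, and such that `x ↦ x / ω x` is nondecreasing on `(0,∞)`. -/
def IsModulus (ω : ℝ → ℝ) : Prop :=
  ContinuousOn ω (Ici 0) ∧ ω 0 = 0 ∧ (∀ x : ℝ, 0 < x → 0 < ω x) ∧
  (∀ x y : ℝ, 0 ≤ x → x ≤ y → ω x ≤ ω y) ∧
  (∀ x y : ℝ, 0 < x → x ≤ y → x / ω x ≤ y / ω y)

/-- The curve `t ↦ (v t k)_k` takes values in `ℓ²` and is continuous on `I`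
with respect to the `ℓ²` norm. -/
def L2Cont (I : Set ℝ) (v : ℝ → ℕ → ℝ) : Prop :=
  (∀ t ∈ I, Summable fun k => (v t k) ^ 2) ∧
  ∀ t ∈ I, ∀ ε : ℝ, 0 < ε → ∃ η > (0:ℝ), ∀ s ∈ I, |s - t| < η →
    (∑' k, (v s k - v t k) ^ 2) < ε

/-- A solution on the interval `I` (which contains `0`) of the Kirchhoff equation
`u'' + 2δ A^σ u' + m(|A^{1/2}u|²) A u = 0` with initial data `(u0, u1)`, in the diagonal
setting where `A` multiplies the `k`-th component by `lam k ^ 2`.  Each component is `C²`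
on `I`, satisfies the componentwise ODE, and the curves `t ↦ u(t)`, `t ↦ A^{1/2}u(t)`,
`t ↦ u'(t)` are continuous with values in `ℓ²`. -/
def IsKirchhoffSol (lam : ℕ → ℝ) (m : ℝ → ℝ) (σ δ : ℝ) (I : Set ℝ)
    (u0 u1 : ℕ → ℝ) (u : ℕ → ℝ → ℝ) : Prop :=
  (∀ k, ContDiffOn ℝ 2 (u k) I) ∧
  (∀ k, u k 0 = u0 k) ∧
  (∀ k, derivWithin (u k) I 0 = u1 k) ∧
  (∀ k, ∀ t ∈ I,
    derivWithin (derivWithin (u k) I) I t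
      + 2 * δ * lam k ^ (2 * σ) * derivWithin (u k) I t
      + m (∑' j, lam j ^ 2 * u j t ^ 2) * lam k ^ 2 * u k t = 0) ∧
  L2Cont I (fun t k => u k t) ∧
  L2Cont I (fun t k => lam k * u k t) ∧
  L2Cont I (fun t k => derivWithin (u k) I t)

/-- The `k`-th summand of the squared seminorm `‖(u0,u1)‖_{ωd}²` of the interpolation
space `V_{ωd}`: it equals `((u1 k)² + (lam k)² (u0 k)²) / ωd (1 / lam k)` when
`lam k > 0`, and `0` otherwise. -/
def Vsum (lam : ℕ → ℝ) (ωd : ℝ → ℝ) (u0 u1 : ℕ → ℝ) (k : ℕ) : ℝ :=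
  if 0 < lam k then (u1 k ^ 2 + lam k ^ 2 * u0 k ^ 2) / ωd (1 / lam k) else 0

/-- Membership in the interpolation space `V_{ωd}` (inside `D(A^{1/2}) × H`). -/
def MemV (lam : ℕ → ℝ) (ωd : ℝ → ℝ) (u0 u1 : ℕ → ℝ) : Prop :=
  (Summable fun k => u0 k ^ 2) ∧ (Summable fun k => lam k ^ 2 * u0 k ^ 2) ∧
  (Summable fun k => u1 k ^ 2) ∧ Summable (Vsum lam ωd u0 u1)

/-- The curve `t ↦ (u(t), u'(t))` lies in `V_{ωd}` for every `t ∈ I` and the weighted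
curves `t ↦ ((ωd(1/λ_k))^{-1/2} λ_k u_k(t))_k` and `t ↦ ((ωd(1/λ_k))^{-1/2} u_k'(t))_k`
(over `k` with `λ_k > 0`) are continuous with values in `ℓ²`. -/
def VRegCurves (lam : ℕ → ℝ) (ωd : ℝ → ℝ) (I : Set ℝ) (u : ℕ → ℝ → ℝ) : Prop :=
  (∀ t ∈ I, Summable (Vsum lam ωd (fun k => u k t) (fun k => derivWithin (u k) I t))) ∧
  L2Cont I (fun t k =>
    if 0 < lam k then lam k * u k t / Real.sqrt (ωd (1 / lam k)) else 0) ∧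
  L2Cont I (fun t k =>
    if 0 < lam k then derivWithin (u k) I t / Real.sqrt (ωd (1 / lam k)) else 0)

/-- The pair `(y, v)` solves `y' = v`, `v' = -2 d v - c l² y` on `I`: a damped oscillator with
time-dependent propagation speed `c`. -/
def IsOscillator (I : Set ℝ) (c : ℝ → ℝ) (d l : ℝ) (y v : ℝ → ℝ) : Prop :=
  ∀ t ∈ I, HasDerivWithinAt y (v t) I t ∧
    HasDerivWithinAt v (-(2 * d * v t) - c t * l ^ 2 * y t) I t

namespace IsOscillator

variable {I J : Set ℝ} {c c' : ℝ → ℝ} {d l : ℝ} {y v y' v' : ℝ → ℝ}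

lemma mono (h : IsOscillator I c d l y v) (hJ : J ⊆ I) : IsOscillator J c d l y v :=
  fun t ht => ⟨(h t (hJ ht)).1.mono hJ, (h t (hJ ht)).2.mono hJ⟩

lemma congr (h : IsOscillator I c d l y v) (hc : EqOn c' c I) (hy : EqOn y' y I)
    (hv : EqOn v' v I) : IsOscillator I c' d l y' v' := by
  intro t ht
  rw [hc ht, hy ht, hv ht]
  exact ⟨(h t ht).1.congr_of_mem hy ht, (h t ht).2.congr_of_mem hv ht⟩

lemma continuousOn_fst (h : IsOscillator I c d l y v) : ContinuousOn y I :=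
  fun t ht => (h t ht).1.continuousWithinAt

lemma continuousOn_snd (h : IsOscillator I c d l y v) : ContinuousOn v I :=
  fun t ht => (h t ht).2.continuousWithinAt

end IsOscillator

/-- A differentiable function on `[0, T]` with nonpositive derivative is bounded by its initial
value. -/
lemma le_initial_of_hasDerivWithinAt_nonpos {T : ℝ} {F F' : ℝ → ℝ}
    (hF : ∀ t ∈ Icc (0 : ℝ) T, HasDerivWithinAt F (F' t) (Icc 0 T) t)
    (hF' : ∀ t ∈ Icc (0 : ℝ) T, F' t ≤ 0) : ∀ t ∈ Icc (0 : ℝ) T, F t ≤ F 0 := by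
  intro t ht
  have hd : ∀ x ∈ interior (Icc (0 : ℝ) T), HasDerivAt F (F' x) x := fun x hx =>
    (hF x (interior_subset hx)).hasDerivAt (mem_interior_iff_mem_nhds.1 hx)
  refine antitoneOn_of_deriv_nonpos (convex_Icc 0 T) (fun x hx => (hF x hx).continuousWithinAt)
    (fun x hx => (hd x hx).differentiableAt.differentiableWithinAt) (fun x hx => ?_)
    ⟨le_rfl, ht.1.trans ht.2⟩ ht ht.1
  rw [(hd x hx).deriv]
  exact hF' x (interior_subset hx)

/-- Energy estimate with exponential growth, useful for low frequencies. -/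
lemma IsOscillator.energy_le_exp {T c₁ d l Λ : ℝ} {c y v : ℝ → ℝ}
    (h : IsOscillator (Icc 0 T) c d l y v) (hc0 : ∀ t, 0 ≤ c t) (hc1 : ∀ t, c t ≤ c₁)
    (hd : 0 ≤ d) (hl : 0 ≤ l) (hΛ : l ≤ Λ) :
    ∀ t ∈ Icc 0 T, v t ^ 2 + l ^ 2 * y t ^ 2 ≤
      Real.exp ((1 + c₁) * Λ * T) * (v 0 ^ 2 + l ^ 2 * y 0 ^ 2) := by
  have hc₁ : 0 ≤ c₁ := (hc0 0).trans (hc1 0)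
  set B : ℝ := (1 + c₁) * Λ with hB
  have hB0 : 0 ≤ B := by have := hl.trans hΛ; positivity
  have key := le_initial_of_hasDerivWithinAt_nonpos (T := T)
    (F := fun t => Real.exp (-(B * t)) * (v t ^ 2 + l ^ 2 * y t ^ 2))
    (F' := fun t => Real.exp (-(B * t)) * (-B) * (v t ^ 2 + l ^ 2 * y t ^ 2)
      + Real.exp (-(B * t)) * (2 * v t * (-(2 * d * v t) - c t * l ^ 2 * y t)
        + l ^ 2 * (2 * y t * v t))) ?_ ?_
  · intro t ht
    have h1 := key t ht
    simp only [mul_zero, neg_zero, Real.exp_zero, one_mul] at h1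
    have h2 : Real.exp (B * t) ≤ Real.exp (B * T) :=
      Real.exp_le_exp.2 (mul_le_mul_of_nonneg_left ht.2 hB0)
    have h3 : v t ^ 2 + l ^ 2 * y t ^ 2 =
        Real.exp (B * t) * (Real.exp (-(B * t)) * (v t ^ 2 + l ^ 2 * y t ^ 2)) := by
      rw [← mul_assoc, ← Real.exp_add]; simp
    rw [h3]
    have : 0 ≤ v 0 ^ 2 + l ^ 2 * y 0 ^ 2 := by positivity
    gcongr
  · intro t ht
    have hy := (h t ht).1
    have hv := (h t ht).2
    have he : HasDerivWithinAt (fun t => Real.exp (-(B * t))) (Real.exp (-(B * t)) * (-B))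
        (Icc 0 T) t := by
      have : HasDerivAt (fun t : ℝ => -(B * t)) (-B) t := by
        simpa using (hasDerivAt_id' t).const_mul (-B)
      exact this.exp.hasDerivWithinAt
    have h2 := (hv.pow 2).add ((hy.pow 2).const_mul (l ^ 2))
    refine (he.mul h2).congr_deriv ?_
    simp
  · intro t ht
    have e0 := Real.exp_pos (-(B * t))
    have hcc : |1 - c t| ≤ 1 + c₁ := by
      rw [abs_le]; constructor <;> linarith [hc0 t, hc1 t]
    have h1 : 2 * (1 - c t) * l * (l * y t * v t) ≤ B * (v t ^ 2 + l ^ 2 * y t ^ 2) := by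
      have e1 : 2 * (l * y t * v t) * (1 - c t) ≤ (v t ^ 2 + l ^ 2 * y t ^ 2) * (1 + c₁) := by
        calc _ ≤ |2 * (l * y t * v t) * (1 - c t)| := le_abs_self _
          _ = |2 * (l * y t * v t)| * |1 - c t| := abs_mul _ _
          _ ≤ _ := by
            gcongr
            rw [abs_le]
            constructor <;> nlinarith [sq_nonneg (v t - l * y t), sq_nonneg (v t + l * y t)]
      have e2 : 0 ≤ (v t ^ 2 + l ^ 2 * y t ^ 2) * (1 + c₁) := by positivity
      calc _ = (2 * (l * y t * v t) * (1 - c t)) * l := by ring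
        _ ≤ ((v t ^ 2 + l ^ 2 * y t ^ 2) * (1 + c₁)) * l := by gcongr
        _ ≤ ((v t ^ 2 + l ^ 2 * y t ^ 2) * (1 + c₁)) * Λ := by gcongr
        _ = _ := by rw [hB]; ring
    have h2 : 0 ≤ d * v t ^ 2 := by positivity
    have : (-B) * (v t ^ 2 + l ^ 2 * y t ^ 2) + (2 * v t * (-(2 * d * v t) - c t * l ^ 2 * y t)
        + l ^ 2 * (2 * y t * v t)) ≤ 0 := by nlinarith
    have h3 := mul_nonpos_of_nonneg_of_nonpos e0.le this
    linarith

/-- Averages of a continuous function over sliding windows of length `1 / l`. -/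
lemma exists_sliding_average {c : ℝ → ℝ} (hc : Continuous c) {l : ℝ} (hl : 0 < l) :
    ∃ C : ℝ → ℝ, (∀ t, HasDerivAt C (l * (c (t + 1 / l) - c t)) t) ∧
      ∀ t, ∃ ξ, |ξ - t| ≤ 1 / l ∧ C t = c ξ := by
  set P : ℝ → ℝ := fun t => ∫ x in (0 : ℝ)..t, c x with hP
  have hPd : ∀ t, HasDerivAt P (c t) t := fun t => hc.integral_hasStrictDerivAt 0 t |>.hasDerivAt
  have hl' : 0 < 1 / l := by positivity
  refine ⟨fun t => l * (P (t + 1 / l) - P t), fun t => ?_, fun t => ?_⟩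
  · exact (((hPd (t + 1 / l)).comp_add_const t (1 / l)).sub (hPd t)).const_mul l
  · obtain ⟨ξ, hξ, h⟩ := exists_hasDerivAt_eq_slope P c (show t < t + 1 / l by linarith)
      (fun x _ => (hPd x).continuousAt.continuousWithinAt) (fun x _ => hPd x)
    refine ⟨ξ, ?_, ?_⟩
    · rw [abs_of_pos (by linarith [hξ.1])]; linarith [hξ.2]
    · rw [h]; field_simp; ring

/-- Energy estimate for high frequencies: the dissipation dominates the oscillations of the
propagation speed at scale `1 / l`. -/
lemma IsOscillator.energy_le_of_dissipation {T μ c₁ δ ρ l q : ℝ} {c y v : ℝ → ℝ}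
    (h : IsOscillator (Icc 0 T) c (δ * ρ) l y v) (hμ : 0 < μ) (hδ : 0 < δ) (hcc : Continuous c)
    (hc0 : ∀ t, μ ≤ c t) (hc1 : ∀ t, c t ≤ c₁)
    (hρ0 : 0 ≤ ρ) (hρ : ρ ≤ l) (hl : 0 < l) 
    (hosc : ∀ t r, |t - r| ≤ 1 / l → |c t - c r| ≤ q) (hq1 : l * q ≤ δ * ρ)
    (hq2 : l * q ≤ μ * δ * ρ) :
    ∀ t ∈ Icc 0 T, v t ^ 2 + l ^ 2 * y t ^ 2 ≤
      (2 + 1 / μ) * (2 + 3 * δ ^ 2 + c₁) * (v 0 ^ 2 + l ^ 2 * y 0 ^ 2) := by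
  obtain ⟨C, hC, hCm⟩ := exists_sliding_average hcc hl
  have hC0 : ∀ t, μ ≤ C t := fun t => by obtain ⟨ξ, -, h⟩ := hCm t; rw [h]; exact hc0 ξ
  have hC1 : ∀ t, C t ≤ c₁ := fun t => by obtain ⟨ξ, -, h⟩ := hCm t; rw [h]; exact hc1 ξ
  have hCc : ∀ t, |C t - c t| ≤ q := fun t => by
    obtain ⟨ξ, h1, h⟩ := hCm t; rw [h]; exact hosc _ _ h1
  have hC' : ∀ t, l * (c (t + 1 / l) - c t) ≤ δ * μ * ρ := fun t => by
    have h1 := (le_abs_self _).trans (hosc (t + 1 / l) t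
      (by rw [add_sub_cancel_left, abs_of_pos (by positivity)]))
    have := mul_le_mul_of_nonneg_left h1 hl.le
    linarith
  set d := δ * ρ with hd
  have hd0 : 0 ≤ d := by positivity
  have key := le_initial_of_hasDerivWithinAt_nonpos (T := T)
    (F := fun t => v t ^ 2 + 2 * d * (y t * v t) + 2 * d ^ 2 * y t ^ 2 + C t * (l ^ 2 * y t ^ 2))
    (F' := fun t => -(2 * d * v t ^ 2) - 2 * d * (c t * (l ^ 2 * y t ^ 2))
      + 2 * (C t - c t) * l ^ 2 * (y t * v t)
      + l * (c (t + 1 / l) - c t) * (l ^ 2 * y t ^ 2)) ?_ ?_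
  · intro t ht
    have h1 := key t ht
    have hdl : d ^ 2 ≤ δ ^ 2 * l ^ 2 := by
      rw [hd, mul_pow]; gcongr
    have e1 : d ^ 2 * y 0 ^ 2 ≤ δ ^ 2 * l ^ 2 * y 0 ^ 2 := by gcongr
    have e2 : C 0 * (l ^ 2 * y 0 ^ 2) ≤ c₁ * (l ^ 2 * y 0 ^ 2) := by gcongr; exact hC1 0
    have e3 : μ * (l ^ 2 * y t ^ 2) ≤ C t * (l ^ 2 * y t ^ 2) := by gcongr; exact hC0 t
    have hc₁ : 0 ≤ c₁ := hμ.le.trans ((hc0 0).trans (hc1 0))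
    have e4 : v 0 ^ 2 + 2 * d * (y 0 * v 0) + 2 * d ^ 2 * y 0 ^ 2 + C 0 * (l ^ 2 * y 0 ^ 2) ≤
        (2 + 3 * δ ^ 2 + c₁) * (v 0 ^ 2 + l ^ 2 * y 0 ^ 2) := by
      have : 0 ≤ (3 * δ ^ 2 + c₁) * v 0 ^ 2 := by positivity
      nlinarith [sq_nonneg (v 0 - d * y 0), sq_nonneg (l * y 0)]
    set F := v t ^ 2 + 2 * d * (y t * v t) + 2 * d ^ 2 * y t ^ 2 + C t * (l ^ 2 * y t ^ 2) with hF
    have hp : 0 ≤ μ * (l ^ 2 * y t ^ 2) := by positivity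
    have e5 : v t ^ 2 ≤ 2 * F := by
      nlinarith [sq_nonneg (v t + 2 * d * y t)]
    have e6 : l ^ 2 * y t ^ 2 ≤ 1 / μ * F := by
      rw [one_div, ← div_eq_inv_mul, le_div_iff₀ hμ]
      nlinarith [sq_nonneg (v t + d * y t), sq_nonneg (d * y t)]
    have hpos : 0 ≤ 2 + 1 / μ := by positivity
    calc _ ≤ (2 + 1 / μ) * F := by linarith
      _ ≤ (2 + 1 / μ) * ((2 + 3 * δ ^ 2 + c₁) * (v 0 ^ 2 + l ^ 2 * y 0 ^ 2)) := by
        exact mul_le_mul_of_nonneg_left (h1.trans e4) hpos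
      _ = _ := by ring
  · intro t ht
    have hy := (h t ht).1
    have hv := (h t ht).2
    have h2 := (((hv.pow 2).add ((hy.mul hv).const_mul (2 * d))).add
      ((hy.pow 2).const_mul (2 * d ^ 2))).add
      ((hC t).hasDerivWithinAt.mul ((hy.pow 2).const_mul (l ^ 2)))
    refine h2.congr_deriv ?_
    simp
    ring
  · intro t ht
    have e1 : 2 * (C t - c t) * l ^ 2 * (y t * v t) ≤ l * q * (v t ^ 2 + l ^ 2 * y t ^ 2) := by
      have e1 : (2 * (l * y t * v t)) * (C t - c t) ≤ (v t ^ 2 + l ^ 2 * y t ^ 2) * q := by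
        calc _ ≤ |2 * (l * y t * v t) * (C t - c t)| := le_abs_self _
          _ = |2 * (l * y t * v t)| * |C t - c t| := abs_mul _ _
          _ ≤ _ := by
            gcongr
            · rw [abs_le]
              constructor <;> nlinarith [sq_nonneg (v t - l * y t), sq_nonneg (v t + l * y t)]
            · exact hCc t
      have := mul_le_mul_of_nonneg_left e1 hl.le
      linarith
    have e2 : l * (c (t + 1 / l) - c t) * (l ^ 2 * y t ^ 2) ≤ μ * d * (l ^ 2 * y t ^ 2) := by
      refine mul_le_mul_of_nonneg_right ?_ (by positivity)
      have := hC' t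
      rw [hd]; linarith
    have e3 : μ * (d * (l ^ 2 * y t ^ 2)) ≤ c t * (d * (l ^ 2 * y t ^ 2)) := by
      refine mul_le_mul_of_nonneg_right (hc0 t) (by positivity)
    have e4 : l * q * v t ^ 2 ≤ d * v t ^ 2 := by gcongr
    have e5 : l * q * (l ^ 2 * y t ^ 2) ≤ μ * d * (l ^ 2 * y t ^ 2) := by
      refine mul_le_mul_of_nonneg_right (by rw [hd]; linarith) (by positivity)
    have e6 : 0 ≤ d * v t ^ 2 := by positivity
    nlinarith

/-- Standing assumptions on the operator, the nonlinearity and the continuity moduli. -/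
structure SubcriticalSetting (lam : ℕ → ℝ) (μ₁ : ℝ) (m ωm : ℝ → ℝ) (σ δ α : ℝ) (ωd : ℝ → ℝ) :
    Prop where
  lam_nonneg : ∀ k, 0 ≤ lam k
  mu_pos : 0 < μ₁
  le_m : ∀ x : ℝ, 0 ≤ x → μ₁ ≤ m x
  modulus_m : IsModulus ωm
  m_sub_le : ∀ a b : ℝ, 0 ≤ a → 0 ≤ b → |m a - m b| ≤ ωm |a - b|
  sigma_pos : 0 < σ
  sigma_le : σ ≤ 1 / 2
  delta_pos : 0 < δ
  alpha_nonneg : 0 ≤ α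
  alpha_lt : α < 1 / 4
  limsup_bound : ∃ C : ℝ, ∀ᶠ x in 𝓝[>] (0:ℝ), ωm x ^ (4 * α) / x ^ (1 - 2 * σ) ≤ C
  modulus_d : IsModulus ωd
  d_one : ωd 1 = 1
  d_le : ∀ x : ℝ, 0 ≤ x → ωd x ≤ x ^ (4 * α)
  d_lim : Tendsto (fun x => ωd x / x ^ (4 * α)) (𝓝[>] (0:ℝ)) (𝓝 0)

namespace IsModulus

variable {ω : ℝ → ℝ}

lemma map_zero (h : IsModulus ω) : ω 0 = 0 := h.2.1

lemma pos (h : IsModulus ω) {x : ℝ} (hx : 0 < x) : 0 < ω x := h.2.2.1 x hx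

lemma mono (h : IsModulus ω) {x y : ℝ} (hx : 0 ≤ x) (hxy : x ≤ y) : ω x ≤ ω y :=
  h.2.2.2.1 x y hx hxy

lemma nonneg (h : IsModulus ω) {x : ℝ} (hx : 0 ≤ x) : 0 ≤ ω x :=
  h.map_zero ▸ h.mono le_rfl hx

lemma div_mono (h : IsModulus ω) {x y : ℝ} (hx : 0 < x) (hxy : x ≤ y) : x / ω x ≤ y / ω y :=
  h.2.2.2.2 x y hx hxy

lemma tendsto_zero (h : IsModulus ω) : Tendsto ω (𝓝[≥] 0) (𝓝 0) := by
  have := h.1 0 self_mem_Ici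
  rwa [ContinuousWithinAt, h.map_zero] at this

end IsModulus

namespace SubcriticalSetting

variable {lam : ℕ → ℝ} {μ₁ : ℝ} {m ωm : ℝ → ℝ} {σ δ α : ℝ} {ωd : ℝ → ℝ}

lemma tendsto_comp_modulus (H : SubcriticalSetting lam μ₁ m ωm σ δ α ωd) {K : ℝ} (hK : 0 ≤ K) :
    Tendsto (fun x => ωm (2 * K * ωd x)) (𝓝[≥] 0) (𝓝 0) := by
  refine H.modulus_m.tendsto_zero.comp (tendsto_nhdsWithin_iff.2 ⟨?_, ?_⟩)
  · simpa using H.modulus_d.tendsto_zero.const_mul (2 * K)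
  · filter_upwards [self_mem_nhdsWithin] with x hx
    have := H.modulus_d.nonneg hx
    simp only [mem_Ici]; positivity

lemma comp_modulus_mono (H : SubcriticalSetting lam μ₁ m ωm σ δ α ωd) {K x y : ℝ} (hK : 0 ≤ K)
    (hx : 0 ≤ x) (hxy : x ≤ y) : ωm (2 * K * ωd x) ≤ ωm (2 * K * ωd y) := by
  have h1 := H.modulus_d.nonneg hx
  have h2 := H.modulus_d.mono hx hxy
  exact H.modulus_m.mono (by positivity) (by gcongr)

lemma continuous_of_modulus (H : SubcriticalSetting lam μ₁ m ωm σ δ α ωd) {K : ℝ} (hK : 0 ≤ K)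
    {c : ℝ → ℝ} (hc : ∀ t r, |c t - c r| ≤ ωm (2 * K * ωd |t - r|)) : Continuous c := by
  refine continuous_iff_continuousAt.2 fun r => ?_
  rw [ContinuousAt, tendsto_iff_dist_tendsto_zero]
  refine squeeze_zero (fun _ => dist_nonneg) (fun t => hc t r) ?_
  refine (H.tendsto_comp_modulus hK).comp (tendsto_nhdsWithin_iff.2 ⟨?_, ?_⟩)
  · have : Continuous fun t : ℝ => |t - r| := by fun_prop
    simpa using this.tendsto r
  · exact Eventually.of_forall fun t => mem_Ici.2 (abs_nonneg _)

/-- The coefficient generated by a bounded trajectory has modulus `o(x^{1-2σ})`. -/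
lemma eventually_comp_modulus_le (H : SubcriticalSetting lam μ₁ m ωm σ δ α ωd) {K κ : ℝ}
    (hK : 0 ≤ K) (hκ : 0 < κ) :
    ∀ᶠ x in 𝓝[>] (0 : ℝ), ωm (2 * K * ωd x) ≤ κ * x ^ (1 - 2 * σ) := by
  have hle : 𝓝[>] (0 : ℝ) ≤ 𝓝[≥] 0 := nhdsWithin_mono _ Ioi_subset_Ici_self
  rcases eq_or_lt_of_le H.sigma_le with hσ | hσ
  · have h1 : (1 : ℝ) - 2 * σ = 0 := by rw [hσ]; norm_num
    simp only [h1, Real.rpow_zero, mul_one]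
    exact ((H.tendsto_comp_modulus hK).mono_left hle).eventually (eventually_le_nhds hκ)
  · set p : ℝ := 1 - 2 * σ with hp
    have hp0 : 0 < p := by rw [hp]; linarith
    obtain ⟨C, hC⟩ := H.limsup_bound
    set a : ℝ := 4 * α with ha
    have ha0 : 0 < a := by
      rcases eq_or_lt_of_le H.alpha_nonneg with h0 | h0
      · exfalso
        simp only [ha, ← h0, mul_zero, Real.rpow_zero] at hC
        have ht : Tendsto (fun x : ℝ => 1 / x ^ p) (𝓝[>] 0) atTop := by
          have h2 : Tendsto (fun x : ℝ => x ^ p) (𝓝[>] 0) (𝓝[>] 0) := by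
            refine tendsto_nhdsWithin_iff.2 ⟨?_, ?_⟩
            · have := (Real.continuousAt_rpow_const 0 p (Or.inr hp0.le)).tendsto
              rw [Real.zero_rpow hp0.ne'] at this
              exact this.mono_left nhdsWithin_le_nhds
            · filter_upwards [self_mem_nhdsWithin] with x hx
              exact Real.rpow_pos_of_pos hx _
          simpa [Function.comp_def] using tendsto_inv_nhdsGT_zero.comp h2
        obtain ⟨x, hx1, hx2⟩ := (hC.and (ht.eventually (eventually_gt_atTop C))).exists
        linarith
      · positivity
    set C' : ℝ := max C 1 with hC'
    have hC'0 : 0 < C' := lt_of_lt_of_le one_pos (le_max_right _ _)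
    set K' : ℝ := 2 * (K + 1) with hK'
    have hK'0 : 0 < K' := by positivity
    obtain ⟨η, hη0, hη⟩ : ∃ η : ℝ, 0 < η ∧ C' * (K' * η) ^ p ≤ κ ^ a := by
      have hcont : Tendsto (fun η : ℝ => C' * (K' * η) ^ p) (𝓝[>] 0) (𝓝 0) := by
        have h1 : Continuous fun η : ℝ => C' * (K' * η) ^ p :=
          continuous_const.mul
            ((continuous_const.mul continuous_id).rpow_const fun _ => Or.inr hp0.le)
        have := h1.tendsto 0
        simp only [mul_zero, Real.zero_rpow hp0.ne'] at this
        exact this.mono_left nhdsWithin_le_nhds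
      have := hcont.eventually (eventually_le_nhds (Real.rpow_pos_of_pos hκ a))
      obtain ⟨η, h1, h2⟩ := (this.and self_mem_nhdsWithin).exists
      exact ⟨η, h2, h1⟩
    have hlim : Tendsto (fun x => K' * ωd x) (𝓝[>] 0) (𝓝[>] 0) := by
      refine tendsto_nhdsWithin_iff.2 ⟨?_, ?_⟩
      · simpa using (H.modulus_d.tendsto_zero.mono_left hle).const_mul K'
      · filter_upwards [self_mem_nhdsWithin] with x hx
        have := H.modulus_d.pos hx
        simp only [mem_Ioi]; positivity
    filter_upwards [hlim.eventually hC, H.d_lim.eventually (eventually_le_nhds hη0),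
      self_mem_nhdsWithin] with x h1 h2 hx
    have hx : 0 < x := hx
    have hd := H.modulus_d.pos hx
    have hxa : 0 < x ^ a := Real.rpow_pos_of_pos hx _
    rw [div_le_iff₀ hxa] at h2
    have hy : 0 < K' * ωd x := by positivity
    rw [div_le_iff₀ (Real.rpow_pos_of_pos hy _)] at h1
    have h3 : ωm (K' * ωd x) ^ a ≤ (κ * x ^ p) ^ a := by
      calc _ ≤ C * (K' * ωd x) ^ p := h1
        _ ≤ C' * (K' * (η * x ^ a)) ^ p := by
          gcongr
          exact le_max_left _ _
        _ = (C' * (K' * η) ^ p) * (x ^ p) ^ a := by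
          rw [← mul_assoc K', Real.mul_rpow (by positivity) hxa.le, ← Real.rpow_mul hx.le,
            ← Real.rpow_mul hx.le, mul_comm a p]
          ring
        _ ≤ κ ^ a * (x ^ p) ^ a := by gcongr
        _ = _ := by rw [Real.mul_rpow hκ.le (by positivity)]
    have h4 : ωm (K' * ωd x) ≤ κ * x ^ p :=
      (Real.rpow_le_rpow_iff (H.modulus_m.nonneg hy.le) (by positivity) ha0).1 h3
    refine le_trans (H.modulus_m.mono (by positivity) ?_) h4
    rw [hK']
    gcongr
    linarith

/-- Above a threshold frequency, the oscillations of the coefficient at scale `1 / l` are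
dominated by the dissipation. -/
lemma exists_threshold (H : SubcriticalSetting lam μ₁ m ωm σ δ α ωd) {K κ : ℝ}
    (hK : 0 ≤ K) (hκ : 0 < κ) :
    ∃ Λ : ℝ, 1 ≤ Λ ∧ ∀ l, Λ ≤ l → l * ωm (2 * K * ωd (1 / l)) ≤ κ * l ^ (2 * σ) := by
  have h1 := (tendsto_inv_atTop_nhdsGT_zero (𝕜 := ℝ)).eventually
    (H.eventually_comp_modulus_le hK hκ)
  obtain ⟨Λ, hΛ⟩ := eventually_atTop.1 h1
  refine ⟨max Λ 1, le_max_right _ _, fun l hl => ?_⟩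
  have hl0 : 0 < l := lt_of_lt_of_le one_pos ((le_max_right _ _).trans hl)
  have h2 := mul_le_mul_of_nonneg_left (hΛ l ((le_max_left _ _).trans hl)) hl0.le
  rw [one_div]
  refine h2.trans_eq ?_
  rw [Real.inv_rpow hl0.le, Real.rpow_sub hl0, Real.rpow_one]
  field_simp

/-- A priori bound for the linear oscillators, uniform in the frequency. -/
lemma exists_linear_bound (H : SubcriticalSetting lam μ₁ m ωm σ δ α ωd) {K : ℝ} (hK : 0 ≤ K)
    (c₁ : ℝ) :
    ∃ Λ : ℝ, 1 ≤ Λ ∧ ∀ (T l : ℝ) (c y v : ℝ → ℝ), 0 ≤ l → (∀ t, μ₁ ≤ c t) → (∀ t, c t ≤ c₁) →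
      (∀ t r, |c t - c r| ≤ ωm (2 * K * ωd |t - r|)) →
      IsOscillator (Icc 0 T) c (δ * l ^ (2 * σ)) l y v →
      ∀ t ∈ Icc 0 T, v t ^ 2 + l ^ 2 * y t ^ 2 ≤
        max ((2 + 1 / μ₁) * (2 + 3 * δ ^ 2 + c₁)) (Real.exp ((1 + c₁) * Λ * T)) *
          (v 0 ^ 2 + l ^ 2 * y 0 ^ 2) := by
  have hμ := H.mu_pos
  have hδ := H.delta_pos
  obtain ⟨Λ, hΛ1, hΛ⟩ := H.exists_threshold hK (lt_min hδ (mul_pos hμ hδ))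
  refine ⟨Λ, hΛ1, fun T l c y v hl hc0 hc1 hcm hosc t ht => ?_⟩
  have hE : 0 ≤ v 0 ^ 2 + l ^ 2 * y 0 ^ 2 := by positivity
  rcases le_total l Λ with h | h
  · refine (hosc.energy_le_exp (fun t => hμ.le.trans (hc0 t)) hc1 (by positivity) hl h t ht).trans ?_
    gcongr
    exact le_max_right _ _
  · have hl1 := hΛ1.trans h
    have hl0 : 0 < l := by linarith
    have hρ : 0 ≤ l ^ (2 * σ) := by positivity
    refine (hosc.energy_le_of_dissipation (q := ωm (2 * K * ωd (1 / l))) hμ hδ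
      (H.continuous_of_modulus hK hcm) hc0 hc1 hρ ?_ hl0 ?_ ?_ ?_ t ht).trans ?_
    · calc l ^ (2 * σ) ≤ l ^ (1 : ℝ) :=
            Real.rpow_le_rpow_of_exponent_le hl1 (by linarith [H.sigma_le])
        _ = l := Real.rpow_one l
    · exact fun t r htr => (hcm t r).trans (H.comp_modulus_mono hK (abs_nonneg _) htr)
    · exact (hΛ l h).trans (by gcongr; exact min_le_left _ _)
    · exact (hΛ l h).trans (by gcongr; exact min_le_right _ _)
    · gcongr
      exact le_max_left _ _

end SubcriticalSetting

section Modulus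

variable {lam : ℕ → ℝ} {ωd : ℝ → ℝ}

lemma Vsum_nonneg (hωd : IsModulus ωd) (a b : ℕ → ℝ) (k : ℕ) : 0 ≤ Vsum lam ωd a b k := by
  unfold Vsum
  split_ifs with h
  · have := hωd.pos (one_div_pos.2 h)
    positivity
  · exact le_rfl

lemma energy_eq_mul_Vsum (hωd : IsModulus ωd) (a b : ℕ → ℝ) {k : ℕ} (hk : 0 < lam k) :
    b k ^ 2 + lam k ^ 2 * a k ^ 2 = ωd (1 / lam k) * Vsum lam ωd a b k := by
  have := hωd.pos (one_div_pos.2 hk)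
  simp only [Vsum, hk, if_true]
  field_simp

/-- Trajectories that are bounded in the interpolation space have a squared `D(A^{1/2})` norm
with continuity modulus controlled by `ωd`. -/
lemma abs_tsum_sub_le (hωd : IsModulus ωd) (hlam : ∀ k, 0 ≤ lam k) {I : Set ℝ}
    (hI : Convex ℝ I) {K : ℝ} {u v : ℕ → ℝ → ℝ}
    (hu : ∀ k, ∀ t ∈ I, HasDerivWithinAt (u k) (v k t) I t)
    (hV : ∀ t ∈ I, ∀ N : Finset ℕ, ∑ k ∈ N, Vsum lam ωd (fun j => u j t) (fun j => v j t) k ≤ K)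
    (hs : ∀ t ∈ I, Summable fun k => lam k ^ 2 * u k t ^ 2) {t r : ℝ} (ht : t ∈ I) (hr : r ∈ I) :
    |(∑' k, lam k ^ 2 * u k t ^ 2) - ∑' k, lam k ^ 2 * u k r ^ 2| ≤ 2 * K * ωd |t - r| := by
  rcases eq_or_ne t r with rfl | hne
  · simp [hωd.map_zero]
  set h : ℝ := |t - r| with hh
  have hpos : 0 < h := abs_pos.2 (sub_ne_zero.2 hne)
  have hωpos := hωd.pos hpos
  have hfin : ∀ N : Finset ℕ, |(∑ k ∈ N, lam k ^ 2 * u k t ^ 2) - ∑ k ∈ N, lam k ^ 2 * u k r ^ 2| ≤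
      2 * K * ωd h := by
    intro N
    set L := N.filter (fun k => lam k ≤ 1 / h) with hL
    set G := N.filter (fun k => ¬ lam k ≤ 1 / h) with hG
    have hsplit : ∀ x : ℝ, ∑ k ∈ N, lam k ^ 2 * u k x ^ 2 =
        (∑ k ∈ L, lam k ^ 2 * u k x ^ 2) + ∑ k ∈ G, lam k ^ 2 * u k x ^ 2 := fun x =>
      (Finset.sum_filter_add_sum_filter_not N _ _).symm
    have hhigh : ∀ x ∈ I, ∑ k ∈ G, lam k ^ 2 * u k x ^ 2 ≤ ωd h * K := by
      intro x hx
      refine le_trans ?_ (mul_le_mul_of_nonneg_left (hV x hx G) hωpos.le)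
      rw [Finset.mul_sum]
      refine Finset.sum_le_sum fun k hk => ?_
      have hk' : 1 / h < lam k := not_le.1 (Finset.mem_filter.1 hk).2
      have hk0 : 0 < lam k := (by positivity : 0 < 1 / h).trans hk'
      have e := energy_eq_mul_Vsum hωd (fun j => u j x) (fun j => v j x) hk0
      have e2 : ωd (1 / lam k) ≤ ωd h := by
        refine hωd.mono (by positivity) ?_
        rw [div_le_iff₀ hk0]
        rw [div_lt_iff₀ hpos] at hk'
        linarith
      have e3 := mul_le_mul_of_nonneg_right e2
        (Vsum_nonneg (lam := lam) hωd (fun j => u j x) (fun j => v j x) k)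
      have : 0 ≤ v k x ^ 2 := by positivity
      linarith
    have hlow : |(∑ k ∈ L, lam k ^ 2 * u k t ^ 2) - ∑ k ∈ L, lam k ^ 2 * u k r ^ 2| ≤
        ωd h * K := by
      have hd : ∀ x ∈ I, HasDerivWithinAt (fun x => ∑ k ∈ L, lam k ^ 2 * u k x ^ 2)
          (∑ k ∈ L, lam k ^ 2 * (2 * u k x * v k x)) I x := by
        intro x hx
        refine HasDerivWithinAt.fun_sum fun k _ => ?_
        refine (((hu k x hx).pow 2).const_mul (lam k ^ 2)).congr_deriv ?_
        simp
      have hb : ∀ x ∈ I, ‖∑ k ∈ L, lam k ^ 2 * (2 * u k x * v k x)‖ ≤ ωd h / h * K := by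
        intro x hx
        refine (norm_sum_le _ _).trans ?_
        refine le_trans ?_ (mul_le_mul_of_nonneg_left (hV x hx L) (by positivity))
        rw [Finset.mul_sum]
        refine Finset.sum_le_sum fun k hk => ?_
        rcases eq_or_lt_of_le (hlam k) with h0 | h0
        · rw [← h0]
          simp only [ne_eq, OfNat.ofNat_ne_zero, not_false_eq_true, zero_pow, zero_mul, norm_zero]
          have := Vsum_nonneg (lam := lam) hωd (fun j => u j x) (fun j => v j x) k
          positivity
        · have hk' : lam k ≤ 1 / h := (Finset.mem_filter.1 hk).2
          have e := energy_eq_mul_Vsum hωd (fun j => u j x) (fun j => v j x) h0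
          have hω := hωd.pos (one_div_pos.2 h0)
          have e2 : lam k * ωd (1 / lam k) ≤ ωd h / h := by
            have := hωd.div_mono hpos (y := 1 / lam k) (by
              rw [le_div_iff₀ h0]; rw [le_div_iff₀ hpos] at hk'; linarith)
            rw [div_le_div_iff₀ hωpos hω] at this
            rw [le_div_iff₀ hpos]
            calc lam k * ωd (1 / lam k) * h = lam k * (h * ωd (1 / lam k)) := by ring
              _ ≤ lam k * (1 / lam k * ωd h) := by gcongr
              _ = ωd h := by field_simp
          have e3 := mul_le_mul_of_nonneg_right e2
            (Vsum_nonneg (lam := lam) hωd (fun j => u j x) (fun j => v j x) k)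
          refine le_trans ?_ e3
          rw [mul_assoc (lam k) (ωd _), ← e, Real.norm_eq_abs]
          have e4 : lam k ^ 2 * (2 * u k x * v k x) = lam k * (2 * (lam k * u k x) * v k x) := by
            ring
          rw [e4, abs_mul, abs_of_pos h0]
          gcongr
          rw [abs_le]
          constructor <;> nlinarith [sq_nonneg (v k x - lam k * u k x),
            sq_nonneg (v k x + lam k * u k x)]
      have := hI.norm_image_sub_le_of_norm_hasDerivWithin_le hd hb hr ht
      rw [Real.norm_eq_abs, Real.norm_eq_abs, ← hh] at this
      refine this.trans_eq ?_
      field_simp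
    rw [hsplit t, hsplit r]
    have g0 : ∀ x, 0 ≤ ∑ k ∈ G, lam k ^ 2 * u k x ^ 2 := fun x =>
      Finset.sum_nonneg fun k _ => by positivity
    have g1 := hhigh t ht
    have g2 := hhigh r hr
    have g3 := g0 t
    have g4 := g0 r
    rw [abs_le] at hlow ⊢
    constructor <;> linarith [hlow.1, hlow.2]
  have hlim := (((hs t ht).hasSum.sub (hs r hr).hasSum)).abs
  refine le_of_tendsto hlim (Eventually.of_forall fun N => ?_)
  rw [Finset.sum_sub_distrib]
  exact hfin N

end Modulus

/-- The right-hand side of the first-order system associated with a damped oscillator. -/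
def oscillatorField (c : ℝ → ℝ) (d l : ℝ) (t : ℝ) (x : ℝ × ℝ) : ℝ × ℝ :=
  (x.2, -(2 * d * x.2) - c t * l ^ 2 * x.1)

lemma norm_oscillatorField_sub_le {c : ℝ → ℝ} {c₁ d l t : ℝ} (hc : |c t| ≤ c₁) (x y : ℝ × ℝ) :
    ‖oscillatorField c d l t x - oscillatorField c d l t y‖ ≤
      (1 + 2 * |d| + c₁ * l ^ 2) * ‖x - y‖ := by
  have h1 : |x.1 - y.1| ≤ ‖x - y‖ := norm_fst_le (x - y)
  have h2 : |x.2 - y.2| ≤ ‖x - y‖ := norm_snd_le (x - y)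
  have hn := norm_nonneg (x - y)
  have hc₁ : 0 ≤ c₁ := (abs_nonneg _).trans hc
  have hp : 0 ≤ (2 * |d| + c₁ * l ^ 2) * ‖x - y‖ := by positivity
  refine (Prod.norm_def _).trans_le (max_le ?_ ?_)
  · simp only [oscillatorField, Prod.fst_sub, Real.norm_eq_abs]
    nlinarith
  · simp only [oscillatorField, Prod.snd_sub, Real.norm_eq_abs]
    calc |(-(2 * d * x.2) - c t * l ^ 2 * x.1) - (-(2 * d * y.2) - c t * l ^ 2 * y.1)|
        = |(-(2 * d)) * (x.2 - y.2) + (-(c t * l ^ 2)) * (x.1 - y.1)| := by ring_nf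
      _ ≤ |(-(2 * d)) * (x.2 - y.2)| + |(-(c t * l ^ 2)) * (x.1 - y.1)| := abs_add_le _ _
      _ = 2 * |d| * |x.2 - y.2| + |c t| * l ^ 2 * |x.1 - y.1| := by
        simp only [abs_mul, abs_neg, abs_pow, sq_abs, Nat.abs_ofNat]
      _ ≤ 2 * |d| * ‖x - y‖ + c₁ * l ^ 2 * ‖x - y‖ := by gcongr
      _ ≤ _ := by linarith

lemma IsOscillator.hasDerivWithinAt_prodMk {T : ℝ} {c : ℝ → ℝ} {d l : ℝ} {y v : ℝ → ℝ}
    (h : IsOscillator (Icc 0 T) c d l y v) {t : ℝ} (ht : t ∈ Ico 0 T) :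
    HasDerivWithinAt (fun t => (y t, v t)) (oscillatorField c d l t (y t, v t)) (Ici t) t := by
  have h1 := h t (Ico_subset_Icc_self ht)
  exact (h1.1.prodMk h1.2).mono_of_mem_nhdsWithin (Icc_mem_nhdsGE_of_mem ht)

lemma IsOscillator.unique {T : ℝ} {c : ℝ → ℝ} {c₁ d l : ℝ} {y v y' v' : ℝ → ℝ}
    (h : IsOscillator (Icc 0 T) c d l y v) (h' : IsOscillator (Icc 0 T) c d l y' v')
    (hc : ∀ t, |c t| ≤ c₁) (hy : y 0 = y' 0) (hv : v 0 = v' 0) :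
    ∀ t ∈ Icc 0 T, y t = y' t ∧ v t = v' t := by
  intro t ht
  have hc₁ : 0 ≤ c₁ := (abs_nonneg _).trans (hc 0)
  have := ODE_solution_unique (v := oscillatorField c d l) (f := fun t => (y t, v t))
    (g := fun t => (y' t, v' t)) (a := 0) (b := T)
    (K := ⟨1 + 2 * |d| + c₁ * l ^ 2, by positivity⟩)
    (fun t => LipschitzWith.of_dist_le_mul fun x y => by
      rw [dist_eq_norm, dist_eq_norm]; exact norm_oscillatorField_sub_le (hc t) x y)
    (h.continuousOn_fst.prodMk h.continuousOn_snd) (fun _ h1 => h.hasDerivWithinAt_prodMk h1)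
    (h'.continuousOn_fst.prodMk h'.continuousOn_snd) (fun _ h1 => h'.hasDerivWithinAt_prodMk h1)
    (by simp [hy, hv]) ht
  simpa using this

/-- Projection of the real line onto `[a, b]`. -/
def clamp (a b x : ℝ) : ℝ := max a (min b x)

lemma abs_clamp_sub_le (a b x y : ℝ) : |clamp a b x - clamp a b y| ≤ |x - y| := by
  unfold clamp
  rw [max_comm a, max_comm a, min_comm b, min_comm b]
  refine (abs_max_sub_max_le_abs _ _ _).trans ?_
  simpa using abs_min_sub_min_le_max x b y b

lemma clamp_mem {a b : ℝ} (h : a ≤ b) (x : ℝ) : clamp a b x ∈ Icc a b :=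
  ⟨le_max_left _ _, max_le h (min_le_left _ _)⟩

lemma clamp_of_mem {a b x : ℝ} (h : x ∈ Icc a b) : clamp a b x = x := by
  rw [clamp, min_eq_right h.2, max_eq_right h.1]

lemma abs_clamp_le {R : ℝ} (hR : 0 ≤ R) (x : ℝ) : |clamp (-R) R x| ≤ |x| := by
  have := abs_clamp_sub_le (-R) R x 0
  rwa [clamp_of_mem (x := 0) ⟨by linarith, hR⟩, sub_zero, sub_zero] at this

/-- Global solvability of the linear oscillator with bounded continuous coefficient. -/
lemma exists_isOscillator {c : ℝ → ℝ} (hc : Continuous c) {c₁ : ℝ} (hc₁ : ∀ t, |c t| ≤ c₁)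
    (d l : ℝ) {T : ℝ} (hT : 0 ≤ T) (a b : ℝ) :
    ∃ y v : ℝ → ℝ, y 0 = a ∧ v 0 = b ∧ IsOscillator (Icc 0 T) c d l y v := by
  have hc₁0 : 0 ≤ c₁ := (abs_nonneg _).trans (hc₁ 0)
  set K : ℝ := 1 + 2 * |d| + c₁ * l ^ 2 with hK
  have hK0 : 0 < K := by positivity
  set R : ℝ := ‖(a, b)‖ * Real.exp (K * T) with hR
  have hR0 : 0 ≤ R := by positivity
  set χ : ℝ × ℝ → ℝ × ℝ := fun x => (clamp (-R) R x.1, clamp (-R) R x.2) with hχ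
  have hχsub : ∀ x y, ‖χ x - χ y‖ ≤ ‖x - y‖ := fun x y =>
    max_le_max (abs_clamp_sub_le _ _ _ _) (abs_clamp_sub_le _ _ _ _)
  have hχle : ∀ x, ‖χ x‖ ≤ ‖x‖ := fun x => max_le_max (abs_clamp_le hR0 _) (abs_clamp_le hR0 _)
  have hχR : ∀ x, ‖χ x‖ ≤ R := fun x => max_le
    (abs_le.2 (clamp_mem (by linarith) _)) (abs_le.2 (clamp_mem (by linarith) _))
  have hχeq : ∀ x, ‖x‖ ≤ R → χ x = x := fun x hx => Prod.ext
    (clamp_of_mem (abs_le.1 ((norm_fst_le x).trans hx)))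
    (clamp_of_mem (abs_le.1 ((norm_snd_le x).trans hx)))
  have hfle : ∀ t x, ‖oscillatorField c d l t x‖ ≤ K * ‖x‖ := fun t x => by
    have h0 : oscillatorField c d l t 0 = 0 := by simp [oscillatorField]
    simpa [h0] using norm_oscillatorField_sub_le (d := d) (l := l) (hc₁ t) x 0
  have hPL : IsPicardLindelof (fun t x => oscillatorField c d l t (χ x)) (tmin := 0) (tmax := T)
      ⟨0, le_rfl, hT⟩ (a, b) ⟨K * R * T, by positivity⟩ 0 ⟨K * R, by positivity⟩
      ⟨K, hK0.le⟩ := by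
    refine ⟨fun t _ => ?_, fun x _ => ?_, fun t _ x _ => ?_, ?_⟩
    · refine (LipschitzWith.of_dist_le_mul fun x y => ?_).lipschitzOnWith
      rw [dist_eq_norm, dist_eq_norm]
      exact (norm_oscillatorField_sub_le (hc₁ t) _ _).trans
        (mul_le_mul_of_nonneg_left (hχsub x y) hK0.le)
    · unfold oscillatorField
      fun_prop
    · exact (hfle t _).trans (mul_le_mul_of_nonneg_left (hχR x) hK0.le)
    · simp only [sub_zero, sub_self, NNReal.coe_zero, max_eq_left hT]
      exact le_rfl
  obtain ⟨α, hα0, hα⟩ := hPL.exists_eq_forall_mem_Icc_hasDerivWithinAt₀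
  simp only at hα0 hα
  have hbound := norm_le_gronwallBound_of_norm_deriv_right_le (f := α) (a := 0) (b := T)
    (f' := fun t => oscillatorField c d l t (χ (α t))) (K := K) (ε := 0) (δ := ‖(a, b)‖)
    (fun t ht => (hα t ht).continuousWithinAt)
    (fun t ht => (hα t (Ico_subset_Icc_self ht)).mono_of_mem_nhdsWithin (Icc_mem_nhdsGE_of_mem ht))
    (by rw [hα0])
    (fun t _ => by
      rw [add_zero]
      exact (hfle t _).trans (mul_le_mul_of_nonneg_left (hχle _) hK0.le))
  have hαR : ∀ t ∈ Icc 0 T, χ (α t) = α t := fun t ht => hχeq _ <| by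
    refine (hbound t ht).trans ?_
    rw [gronwallBound_ε0, sub_zero, hR]
    gcongr
    exact ht.2
  refine ⟨fun t => (α t).1, fun t => (α t).2, by simp [hα0], by simp [hα0], fun t ht => ?_⟩
  have h1 := hα t ht
  rw [hαR t ht] at h1
  exact ⟨(hasFDerivAt_fst (𝕜 := ℝ) (p := α t)).comp_hasDerivWithinAt t h1,
    (hasFDerivAt_snd (𝕜 := ℝ) (p := α t)).comp_hasDerivWithinAt t h1⟩

/-- A first-order expansion with a remainder controlled by a modulus of the derivative. -/
lemma abs_sub_sub_mul_le {T : ℝ} {f f' w : ℝ → ℝ}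
    (hf : ∀ t ∈ Icc (0 : ℝ) T, HasDerivWithinAt f (f' t) (Icc 0 T) t)
    (hw : ∀ x y, 0 ≤ x → x ≤ y → w x ≤ w y)
    (hf' : ∀ t ∈ Icc (0 : ℝ) T, ∀ r ∈ Icc (0 : ℝ) T, |f' t - f' r| ≤ w |t - r|)
    {t r : ℝ} (ht : t ∈ Icc (0 : ℝ) T) (hr : r ∈ Icc (0 : ℝ) T) :
    |f t - f r - (t - r) * f' r| ≤ w |t - r| * |t - r| := by
  have hsub : uIcc r t ⊆ Icc 0 T := (convex_Icc (0 : ℝ) T).ordConnected.uIcc_subset hr ht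
  have hd : ∀ x ∈ uIcc r t, HasDerivWithinAt (fun x => f x - x * f' r) (f' x - f' r)
      (uIcc r t) x := fun x hx => by
    have := ((hf x (hsub hx)).mono hsub).fun_sub ((hasDerivWithinAt_id x (uIcc r t)).mul_const (f' r))
    simpa using this
  have hb : ∀ x ∈ uIcc r t, ‖f' x - f' r‖ ≤ w |t - r| := fun x hx =>
    (hf' x (hsub hx) r hr).trans (hw _ _ (abs_nonneg _) (abs_sub_left_of_mem_uIcc hx))
  have := (convex_uIcc r t).norm_image_sub_le_of_norm_hasDerivWithin_le hd hb
    left_mem_uIcc right_mem_uIcc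
  rw [Real.norm_eq_abs, Real.norm_eq_abs] at this
  refine le_trans (le_of_eq ?_) this
  congr 1
  ring

lemma hasDerivWithinAt_of_abs_le {I : Set ℝ} {f w : ℝ → ℝ} {e r : ℝ}
    (hw : Tendsto w (𝓝[≥] 0) (𝓝 0))
    (hf : ∀ t ∈ I, |f t - f r - (t - r) * e| ≤ w |t - r| * |t - r|) :
    HasDerivWithinAt f e I r := by
  rw [hasDerivWithinAt_iff_tendsto]
  have habs : Tendsto (fun t : ℝ => |t - r|) (𝓝[I] r) (𝓝[≥] 0) := by
    refine tendsto_nhdsWithin_iff.2 ⟨?_, Eventually.of_forall fun t => mem_Ici.2 (abs_nonneg _)⟩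
    have : Continuous fun t : ℝ => |t - r| := by fun_prop
    simpa using (this.tendsto r).mono_left nhdsWithin_le_nhds
  refine tendsto_of_tendsto_of_tendsto_of_le_of_le' tendsto_const_nhds
    (by simpa using (hw.comp habs).abs)
    (Eventually.of_forall fun t => by positivity) ?_
  filter_upwards [self_mem_nhdsWithin] with t ht
  simp only [Real.norm_eq_abs, smul_eq_mul]
  rcases eq_or_ne t r with rfl | hne
  · simp
  · have hpos : 0 < |t - r| := abs_pos.2 (sub_ne_zero.2 hne)
    rw [← div_eq_inv_mul, div_le_iff₀ hpos]
    exact (hf t ht).trans (by gcongr; exact le_abs_self _)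

/-- Pointwise limits of oscillators with equicontinuous coefficients are oscillators. -/
lemma IsOscillator.of_tendsto {ι : Type*} {F : Filter ι} [F.NeBot] {T c₁ A B d l : ℝ}
    {w : ℝ → ℝ} {c y v : ι → ℝ → ℝ} {c' y' v' : ℝ → ℝ}
    (h : ∀ n, IsOscillator (Icc 0 T) (c n) d l (y n) (v n))
    (hw : Tendsto w (𝓝[≥] 0) (𝓝 0)) (hw' : ∀ x y, 0 ≤ x → x ≤ y → w x ≤ w y)
    (hd : 0 ≤ d) (hA : 0 ≤ A) (hB : 0 ≤ B)
    (hc : ∀ n t, |c n t| ≤ c₁) (hcw : ∀ n t r, |c n t - c n r| ≤ w |t - r|)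
    (hy : ∀ n, ∀ t ∈ Icc 0 T, |y n t| ≤ A) (hv : ∀ n, ∀ t ∈ Icc 0 T, |v n t| ≤ B)
    (hclim : ∀ t ∈ Icc 0 T, Tendsto (fun n => c n t) F (𝓝 (c' t)))
    (hylim : ∀ t ∈ Icc 0 T, Tendsto (fun n => y n t) F (𝓝 (y' t)))
    (hvlim : ∀ t ∈ Icc 0 T, Tendsto (fun n => v n t) F (𝓝 (v' t))) :
    IsOscillator (Icc 0 T) c' d l y' v' := by
  obtain ⟨n₀⟩ : Nonempty ι := F.nonempty_of_neBot
  have hc₁ : 0 ≤ c₁ := (abs_nonneg _).trans (hc n₀ 0)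
  set D : ℝ := 2 * d * B + c₁ * l ^ 2 * A with hD
  have hD0 : 0 ≤ D := by positivity
  have hacc : ∀ n, ∀ t ∈ Icc 0 T, |-(2 * d * v n t) - c n t * l ^ 2 * y n t| ≤ D := by
    intro n t ht
    refine (abs_sub _ _).trans ?_
    rw [abs_neg, abs_mul, abs_mul (c n t * l ^ 2), abs_mul (c n t), abs_of_nonneg
      (by positivity : 0 ≤ 2 * d), abs_of_nonneg (sq_nonneg l)]
    have h1 := hc n t
    have h2 := hy n t ht
    have h3 := hv n t ht
    rw [hD]
    gcongr
  have hylip : ∀ n, ∀ t ∈ Icc 0 T, ∀ r ∈ Icc 0 T, |y n t - y n r| ≤ B * |t - r| :=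
    fun n t ht r hr => (convex_Icc 0 T).norm_image_sub_le_of_norm_hasDerivWithin_le
      (fun x hx => (h n x hx).1) (fun x hx => hv n x hx) hr ht
  have hvlip : ∀ n, ∀ t ∈ Icc 0 T, ∀ r ∈ Icc 0 T, |v n t - v n r| ≤ D * |t - r| :=
    fun n t ht r hr => (convex_Icc 0 T).norm_image_sub_le_of_norm_hasDerivWithin_le
      (fun x hx => (h n x hx).2) (fun x hx => hacc n x hx) hr ht
  set w₂ : ℝ → ℝ := fun x => 2 * d * (D * x) + l ^ 2 * (c₁ * (B * x) + w x * A) with hw₂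
  have hacclip : ∀ n, ∀ t ∈ Icc 0 T, ∀ r ∈ Icc 0 T,
      |(-(2 * d * v n t) - c n t * l ^ 2 * y n t) - (-(2 * d * v n r) - c n r * l ^ 2 * y n r)| ≤
        w₂ |t - r| := by
    intro n t ht r hr
    have e : (-(2 * d * v n t) - c n t * l ^ 2 * y n t) -
        (-(2 * d * v n r) - c n r * l ^ 2 * y n r) =
        -(2 * d * (v n t - v n r)) -
          l ^ 2 * (c n t * (y n t - y n r) + (c n t - c n r) * y n r) := by ring
    rw [e]
    refine (abs_sub _ _).trans ?_
    rw [abs_neg, abs_mul, abs_mul (l ^ 2), abs_of_nonneg (by positivity : 0 ≤ 2 * d),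
      abs_of_nonneg (sq_nonneg l)]
    have h1 : |c n t * (y n t - y n r) + (c n t - c n r) * y n r| ≤
        c₁ * (B * |t - r|) + w |t - r| * A := by
      refine (abs_add_le _ _).trans ?_
      rw [abs_mul, abs_mul]
      have hw0 : 0 ≤ w |t - r| := (abs_nonneg _).trans (hcw n t r)
      exact add_le_add (mul_le_mul (hc n t) (hylip n t ht r hr) (abs_nonneg _) hc₁)
        (mul_le_mul (hcw n t r) (hy n r hr) (abs_nonneg _) hw0)
    have h2 := hvlip n t ht r hr
    simp only [hw₂]
    gcongr
  have hw₂mono : ∀ x y, 0 ≤ x → x ≤ y → w₂ x ≤ w₂ y := fun x y hx hxy => by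
    have := hw' x y hx hxy
    simp only [hw₂]
    gcongr
  have hw₂lim : Tendsto w₂ (𝓝[≥] 0) (𝓝 0) := by
    have hid : Tendsto (fun x : ℝ => x) (𝓝[≥] 0) (𝓝 0) := nhdsWithin_le_nhds
    have := ((hid.const_mul D).const_mul (2 * d)).add
      ((((hid.const_mul B).const_mul c₁).add (hw.mul_const A)).const_mul (l ^ 2))
    simpa using this
  have hlin : Tendsto (fun x : ℝ => D * x) (𝓝[≥] 0) (𝓝 0) := by
    have hid : Tendsto (fun x : ℝ => x) (𝓝[≥] 0) (𝓝 0) := nhdsWithin_le_nhds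
    simpa using hid.const_mul D
  intro r hr
  constructor
  · refine hasDerivWithinAt_of_abs_le hlin fun t ht => ?_
    refine le_of_tendsto (((hylim t ht).sub (hylim r hr)).sub ((hvlim r hr).const_mul (t - r))).abs
      (Eventually.of_forall fun n => ?_)
    exact abs_sub_sub_mul_le (w := fun x => D * x) (fun x hx => (h n x hx).1)
      (fun x y _ hxy => by gcongr) (hvlip n) ht hr
  · refine hasDerivWithinAt_of_abs_le hw₂lim fun t ht => ?_
    refine le_of_tendsto (((hvlim t ht).sub (hvlim r hr)).sub
      (((((hvlim r hr).const_mul (2 * d)).neg).sub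
        (((hclim r hr).mul_const (l ^ 2)).mul (hylim r hr))).const_mul (t - r))).abs
      (Eventually.of_forall fun n => ?_)
    exact abs_sub_sub_mul_le (fun x hx => (h n x hx).2) hw₂mono (hacclip n) ht hr

lemma exists_tendsto_of_bounded {ι : Type*} (F : Ultrafilter ι) {x : ι → ℝ} {B : ℝ}
    (h : ∀ n, |x n| ≤ B) : ∃ y, Tendsto x F (𝓝 y) := by
  obtain ⟨y, -, hy⟩ := (isCompact_Icc (a := -B) (b := B)).ultrafilter_le_nhds (F.map x)
    (le_principal_iff.2 (mem_map.2 (univ_mem' fun n => abs_le.1 (h n))))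
  exact ⟨y, hy⟩

/-- A solution of the Kirchhoff equation on `I`, as a pair `(u, u')` with `u' = v`, whose
componentwise energies are locally controlled by the initial ones. -/
structure IsTrajectory (lam : ℕ → ℝ) (m : ℝ → ℝ) (σ δ : ℝ) (I : Set ℝ) (a b : ℕ → ℝ)
    (u v : ℕ → ℝ → ℝ) : Prop where
  init_fst : ∀ k, u k 0 = a k
  init_snd : ∀ k, v k 0 = b k
  osc : ∀ k, IsOscillator I (fun t => m (∑' j, lam j ^ 2 * u j t ^ 2)) (δ * lam k ^ (2 * σ))
    (lam k) (u k) (v k)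
  bound : ∀ T ∈ I, ∃ C, 0 ≤ C ∧ ∀ k, ∀ t ∈ Icc 0 T,
    v k t ^ 2 + lam k ^ 2 * u k t ^ 2 ≤ C * (b k ^ 2 + lam k ^ 2 * a k ^ 2)

section Domination

variable {lam : ℕ → ℝ} {ωd : ℝ → ℝ} {a b u v : ℕ → ℝ} {C : ℝ}

lemma Vsum_le_mul (hωd : IsModulus ωd) {k : ℕ}
    (h : v k ^ 2 + lam k ^ 2 * u k ^ 2 ≤ C * (b k ^ 2 + lam k ^ 2 * a k ^ 2)) :
    Vsum lam ωd u v k ≤ C * Vsum lam ωd a b k := by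
  unfold Vsum
  split_ifs with hk
  · have := hωd.pos (one_div_pos.2 hk)
    rw [← mul_div_assoc]
    gcongr
  · simp

lemma MemV.summable_energy (h : MemV lam ωd a b) (C : ℝ) :
    Summable fun k => C * (b k ^ 2 + lam k ^ 2 * a k ^ 2) :=
  (h.2.2.1.add h.2.1).mul_left C

lemma MemV.summable_of_energy_le (hV : MemV lam ωd a b)
    (h : ∀ k, v k ^ 2 + lam k ^ 2 * u k ^ 2 ≤ C * (b k ^ 2 + lam k ^ 2 * a k ^ 2)) :
    Summable fun k => lam k ^ 2 * u k ^ 2 :=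
  Summable.of_nonneg_of_le (fun k => by positivity)
    (fun k => le_trans (le_add_of_nonneg_left (sq_nonneg _)) (h k)) (hV.summable_energy C)

lemma MemV.sum_Vsum_le (hωd : IsModulus ωd) (hV : MemV lam ωd a b) (hC : 0 ≤ C)
    (h : ∀ k, v k ^ 2 + lam k ^ 2 * u k ^ 2 ≤ C * (b k ^ 2 + lam k ^ 2 * a k ^ 2))
    (N : Finset ℕ) : ∑ k ∈ N, Vsum lam ωd u v k ≤ C * ∑' k, Vsum lam ωd a b k := by
  refine (Finset.sum_le_sum fun k _ => Vsum_le_mul hωd (h k)).trans ?_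
  rw [← Finset.mul_sum]
  exact mul_le_mul_of_nonneg_left (hV.2.2.2.sum_le_tsum N fun k _ => Vsum_nonneg hωd _ _ k) hC

end Domination

/-- Stepwise solvability of a functional equation with delay `h`. -/
lemma exists_delayed_fixedPoint {A : (ℝ → ℝ) → Prop} {G : (ℝ → ℝ) → ℝ → ℝ} {c₀ : ℝ → ℝ} {h : ℝ}
    (hh : 0 ≤ h) (h₀ : A c₀) (hG : ∀ c, A c → A fun t => G c (t - h))
    (hbase : ∀ c, A c → ∀ t ≤ 0, G c t = c₀ t) (hc₀ : ∀ t, c₀ t = c₀ 0)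
    (hcaus : ∀ c c' t, A c → A c' → (∀ r ≤ max 0 t, c r = c' r) → G c t = G c' t) (n : ℕ) :
    ∃ c, A c ∧ ∀ t ≤ n * h, c t = G c (t - h) := by
  induction n with
  | zero =>
    refine ⟨c₀, h₀, fun t ht => ?_⟩
    rw [hbase c₀ h₀ _ (by simp at ht; linarith), hc₀ t, hc₀ (t - h)]
  | succ n ih =>
    obtain ⟨c, hc, hfix⟩ := ih
    refine ⟨fun t => G c (t - h), hG c hc, fun t ht => ?_⟩
    refine hcaus c _ _ hc (hG c hc) fun r hr => hfix r (hr.trans (max_le (by positivity) ?_))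
    push_cast at ht
    linarith

/-- The propagation speeds allowed in the linearized problems. -/
structure IsSpeed (μ₁ c₁ : ℝ) (w c : ℝ → ℝ) : Prop where
  le : ∀ t, μ₁ ≤ c t
  ge : ∀ t, c t ≤ c₁
  sub_le : ∀ t r, |c t - c r| ≤ w |t - r|

namespace SubcriticalSetting

variable {lam : ℕ → ℝ} {μ₁ : ℝ} {m ωm : ℝ → ℝ} {σ δ α : ℝ} {ωd : ℝ → ℝ} {a b : ℕ → ℝ}

/-- The speed generated by a family of functions with bounded interpolation norm, extended to the
whole line by constants, is admissible. -/
lemma isSpeed_clamp (H : SubcriticalSetting lam μ₁ m ωm σ δ α ωd) {T K c₁ : ℝ} (hT : 0 ≤ T)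
    (hK : 0 ≤ K) {u v : ℕ → ℝ → ℝ}
    (hu : ∀ k, ∀ t ∈ Icc 0 T, HasDerivWithinAt (u k) (v k t) (Icc 0 T) t)
    (hV : ∀ t ∈ Icc 0 T, ∀ N : Finset ℕ,
      ∑ k ∈ N, Vsum lam ωd (fun j => u j t) (fun j => v j t) k ≤ K)
    (hs : ∀ t ∈ Icc 0 T, Summable fun k => lam k ^ 2 * u k t ^ 2)
    (hc₁ : m (∑' k, lam k ^ 2 * u k 0 ^ 2) + ωm (2 * K * ωd T) ≤ c₁) :
    IsSpeed μ₁ c₁ (fun x => ωm (2 * K * ωd x))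
      (fun t => m (∑' k, lam k ^ 2 * u k (clamp 0 T t) ^ 2)) := by
  have hs0 : ∀ t, 0 ≤ ∑' k, lam k ^ 2 * u k t ^ 2 := fun t => tsum_nonneg fun k => by positivity
  have key : ∀ t ∈ Icc 0 T, ∀ r ∈ Icc 0 T,
      |m (∑' k, lam k ^ 2 * u k t ^ 2) - m (∑' k, lam k ^ 2 * u k r ^ 2)| ≤
        ωm (2 * K * ωd |t - r|) := fun t ht r hr =>
    (H.m_sub_le _ _ (hs0 t) (hs0 r)).trans (H.modulus_m.mono (abs_nonneg _)
      (abs_tsum_sub_le H.modulus_d H.lam_nonneg (convex_Icc 0 T) hu hV hs ht hr))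
  refine ⟨fun t => H.le_m _ (hs0 _), fun t => ?_, fun t r => ?_⟩
  · have ht := clamp_mem hT t
    have h1 := key _ ht 0 ⟨le_rfl, hT⟩
    have h2 : ωm (2 * K * ωd |clamp 0 T t - 0|) ≤ ωm (2 * K * ωd T) :=
      H.comp_modulus_mono hK (abs_nonneg _) (by rw [sub_zero, abs_of_nonneg ht.1]; exact ht.2)
    have h3 := (abs_le.1 (h1.trans h2)).2
    linarith
  · exact (key _ (clamp_mem hT t) _ (clamp_mem hT r)).trans
      (H.comp_modulus_mono hK (abs_nonneg _) (abs_clamp_sub_le 0 T t r))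

/-- A bound on the interpolation norm controls every component by its initial energy. -/
lemma exists_energy_bound (H : SubcriticalSetting lam μ₁ m ωm σ δ α ωd) {K : ℝ} (hK : 0 ≤ K)
    (T₀ : ℝ) (a : ℕ → ℝ) :
    ∃ C, 0 ≤ C ∧ ∀ T ∈ Icc 0 T₀, ∀ u v : ℕ → ℝ → ℝ, (∀ k, u k 0 = a k) →
      (∀ k, IsOscillator (Icc 0 T) (fun t => m (∑' j, lam j ^ 2 * u j t ^ 2))
        (δ * lam k ^ (2 * σ)) (lam k) (u k) (v k)) →
      (∀ t ∈ Icc 0 T, Summable fun k => lam k ^ 2 * u k t ^ 2) →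
      (∀ t ∈ Icc 0 T, ∀ N : Finset ℕ,
        ∑ k ∈ N, Vsum lam ωd (fun j => u j t) (fun j => v j t) k ≤ K) →
      ∀ k, ∀ t ∈ Icc 0 T,
        v k t ^ 2 + lam k ^ 2 * u k t ^ 2 ≤ C * (v k 0 ^ 2 + lam k ^ 2 * u k 0 ^ 2) := by
  set c₁ := m (∑' k, lam k ^ 2 * a k ^ 2) + ωm (2 * K * ωd T₀) with hc₁
  obtain ⟨Λ, hΛ1, hΛ⟩ := H.exists_linear_bound hK c₁
  refine ⟨max ((2 + 1 / μ₁) * (2 + 3 * δ ^ 2 + c₁)) (Real.exp ((1 + c₁) * Λ * T₀)),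
    le_max_of_le_right (Real.exp_pos _).le, ?_⟩
  intro T hT u v hu hosc hs hV k t ht
  have h1 := H.comp_modulus_mono hK hT.1 hT.2
  have hsp := H.isSpeed_clamp (c₁ := c₁) hT.1 hK (fun k t ht => (hosc k t ht).1) hV hs (by
    simp only [hu]
    rw [hc₁]
    linarith)
  have hc₁0 : 0 ≤ c₁ := H.mu_pos.le.trans ((hsp.le 0).trans (hsp.ge 0))
  refine (hΛ T (lam k) _ (u k) (v k) (H.lam_nonneg k) hsp.le hsp.ge hsp.sub_le
    ((hosc k).congr (fun t ht => ?_) (fun _ _ => rfl) (fun _ _ => rfl)) t ht).trans ?_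
  · simp only [clamp_of_mem ht]
  · have := hT.2
    gcongr

end SubcriticalSetting

/-- The curve of oscillators with bounded energy stays bounded. -/
lemma abs_le_add_of_abs_deriv_le {T B : ℝ} {y v : ℝ → ℝ}
    (hy : ∀ t ∈ Icc 0 T, HasDerivWithinAt y (v t) (Icc 0 T) t)
    (hv : ∀ t ∈ Icc 0 T, |v t| ≤ B) (hB : 0 ≤ B) {t : ℝ} (ht : t ∈ Icc 0 T) :
    |y t| ≤ |y 0| + B * T := by
  have h1 : |y t - y 0| ≤ B * |t - 0| := (convex_Icc 0 T).norm_image_sub_le_of_norm_hasDerivWithin_le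
    hy hv ⟨le_rfl, ht.1.trans ht.2⟩ ht
  rw [sub_zero, abs_of_nonneg ht.1] at h1
  have h2 := abs_sub_abs_le_abs_sub (y t) (y 0)
  have h3 : B * t ≤ B * T := mul_le_mul_of_nonneg_left ht.2 hB
  linarith

namespace SubcriticalSetting

variable {lam : ℕ → ℝ} {μ₁ : ℝ} {m ωm : ℝ → ℝ} {σ δ α : ℝ} {ωd : ℝ → ℝ} {a b : ℕ → ℝ}

lemma tendsto_m (H : SubcriticalSetting lam μ₁ m ωm σ δ α ωd) {ι : Type*} {F : Filter ι}
    {s : ι → ℝ} {s' : ℝ} (hs : Tendsto s F (𝓝 s')) (h0 : ∀ n, 0 ≤ s n) (h0' : 0 ≤ s') :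
    Tendsto (fun n => m (s n)) F (𝓝 (m s')) := by
  rw [tendsto_iff_dist_tendsto_zero]
  refine squeeze_zero (fun _ => dist_nonneg) (fun n => H.m_sub_le _ _ (h0 n) h0') ?_
  refine H.modulus_m.tendsto_zero.comp (tendsto_nhdsWithin_iff.2
    ⟨?_, Eventually.of_forall fun n => mem_Ici.2 (abs_nonneg _)⟩)
  simpa using (hs.sub_const s').abs

/-- Local existence for data in the interpolation space. -/
lemma exists_local (H : SubcriticalSetting lam μ₁ m ωm σ δ α ωd) (hab : MemV lam ωd a b) :
    ∃ τ > 0, ∃ u v, IsTrajectory lam m σ δ (Icc 0 τ) a b u v := by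
  have hωd := H.modulus_d
  set e : ℕ → ℝ := fun k => b k ^ 2 + lam k ^ 2 * a k ^ 2 with he
  have he0 : ∀ k, 0 ≤ e k := fun k => by positivity
  set s₀ : ℝ := ∑' k, lam k ^ 2 * a k ^ 2 with hs₀
  have hs₀0 : 0 ≤ s₀ := tsum_nonneg fun k => by positivity
  have hms₀ : μ₁ ≤ m s₀ := H.le_m _ hs₀0
  have hμ := H.mu_pos
  set c₁ : ℝ := m s₀ + 1 with hc₁
  have hc₁0 : 0 < c₁ := by linarith
  set C : ℝ := max ((2 + 1 / μ₁) * (2 + 3 * δ ^ 2 + c₁)) (Real.exp 1) with hC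
  have hC0 : 0 ≤ C := le_max_of_le_right (Real.exp_pos _).le
  set K : ℝ := C * ∑' k, Vsum lam ωd a b k with hKdef
  have hK : 0 ≤ K := mul_nonneg hC0 (tsum_nonneg fun k => Vsum_nonneg hωd _ _ k)
  obtain ⟨Λ, hΛ1, hΛ⟩ := H.exists_linear_bound hK c₁
  set w : ℝ → ℝ := fun x => ωm (2 * K * ωd x) with hw
  have hwlim : Tendsto w (𝓝[≥] 0) (𝓝 0) := H.tendsto_comp_modulus hK
  have hwmono : ∀ x y, 0 ≤ x → x ≤ y → w x ≤ w y := fun x y hx hxy => H.comp_modulus_mono hK hx hxy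
  obtain ⟨τ, hτ0, hτw, hτΛ⟩ : ∃ τ : ℝ, 0 < τ ∧ w τ ≤ 1 ∧ (1 + c₁) * Λ * τ ≤ 1 := by
    have h1 : ∀ᶠ x in 𝓝[>] (0 : ℝ), w x < 1 :=
      (hwlim.mono_left (nhdsWithin_mono _ Ioi_subset_Ici_self)).eventually (gt_mem_nhds one_pos)
    have h2 : ∀ᶠ x in 𝓝[>] (0 : ℝ), (1 + c₁) * Λ * x < 1 := by
      have : Tendsto (fun x : ℝ => (1 + c₁) * Λ * x) (𝓝[>] 0) (𝓝 ((1 + c₁) * Λ * 0)) :=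
        (tendsto_id.mono_left nhdsWithin_le_nhds).const_mul _
      rw [mul_zero] at this
      exact this.eventually (gt_mem_nhds one_pos)
    obtain ⟨x, ⟨hx1, hx2⟩, hx0⟩ := ((h1.and h2).and self_mem_nhdsWithin).exists
    exact ⟨x, hx0, hx1.le, hx2.le⟩
  set A : (ℝ → ℝ) → Prop := IsSpeed μ₁ c₁ w with hA
  have habs : ∀ c, A c → ∀ t, |c t| ≤ c₁ := fun c hc t =>
    abs_le.2 ⟨by linarith [hc.le t], hc.ge t⟩
  have hlin : ∀ c, A c → ∃ U V : ℕ → ℝ → ℝ, (∀ k, U k 0 = a k) ∧ (∀ k, V k 0 = b k) ∧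
      ∀ k, IsOscillator (Icc 0 τ) c (δ * lam k ^ (2 * σ)) (lam k) (U k) (V k) := by
    intro c hc
    choose U V h using fun k => exists_isOscillator (H.continuous_of_modulus hK hc.sub_le)
      (habs c hc) (δ * lam k ^ (2 * σ)) (lam k) hτ0.le (a k) (b k)
    exact ⟨U, V, fun k => (h k).1, fun k => (h k).2.1, fun k => (h k).2.2⟩
  choose! U V hU0 hV0 hosc using hlin
  have hE : ∀ c, A c → ∀ k, ∀ t ∈ Icc 0 τ, V c k t ^ 2 + lam k ^ 2 * U c k t ^ 2 ≤ C * e k := by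
    intro c hc k t ht
    have := hΛ τ (lam k) c (U c k) (V c k) (H.lam_nonneg k) hc.le hc.ge hc.sub_le (hosc c hc k) t ht
    rw [hU0 c hc, hV0 c hc] at this
    refine this.trans (mul_le_mul_of_nonneg_right ?_ (he0 k))
    exact max_le_max le_rfl (Real.exp_le_exp.2 hτΛ)
  set S : (ℝ → ℝ) → ℝ → ℝ := fun c t => ∑' k, lam k ^ 2 * U c k t ^ 2 with hS
  have hS0 : ∀ c t, 0 ≤ S c t := fun c t => tsum_nonneg fun k => by positivity
  set G : (ℝ → ℝ) → ℝ → ℝ := fun c t => m (S c (clamp 0 τ t)) with hG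
  have hSinit : ∀ c, A c → S c 0 = s₀ := fun c hc => by simp only [hS, hU0 c hc, hs₀]
  have hGA : ∀ c, A c → A (G c) := fun c hc =>
    H.isSpeed_clamp hτ0.le hK (fun k t ht => (hosc c hc k t ht).1)
      (fun t ht N => hab.sum_Vsum_le hωd hC0 (fun k => hE c hc k t ht) N)
      (fun t ht => hab.summable_of_energy_le (fun k => hE c hc k t ht))
      (add_le_add (congrArg m (hSinit c hc)).le hτw)
  have hGshift : ∀ h c, A c → A fun t => G c (t - h) := fun h c hc =>
    ⟨fun t => (hGA c hc).le _, fun t => (hGA c hc).ge _, fun t r => by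
      simpa using (hGA c hc).sub_le (t - h) (r - h)⟩
  have hcaus : ∀ c c' t, A c → A c' → (∀ r ≤ max 0 t, c r = c' r) → G c t = G c' t := by
    intro c c' t hc hc' hcc
    have hx := clamp_mem hτ0.le t
    have hxt : clamp 0 τ t ≤ max 0 t := max_le_max le_rfl (min_le_right _ _)
    have hsub : Icc 0 (clamp 0 τ t) ⊆ Icc 0 τ := Icc_subset_Icc le_rfl hx.2
    have : ∀ k, U c k (clamp 0 τ t) = U c' k (clamp 0 τ t) := fun k =>
      (((hosc c hc k).mono hsub).unique (((hosc c' hc' k).mono hsub).congr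
        (fun r hr => hcc r (hr.2.trans hxt)) (fun _ _ => rfl) (fun _ _ => rfl)) (habs c hc)
        (by rw [hU0 c hc, hU0 c' hc']) (by rw [hV0 c hc, hV0 c' hc']) _ ⟨hx.1, le_rfl⟩).1
    simp only [hG, hS, this]
  have hconst : A fun _ => m s₀ := ⟨fun _ => hms₀, fun _ => by linarith, fun t r => by
    simpa using H.modulus_m.nonneg (by have := hωd.nonneg (abs_nonneg (t - r)); positivity)⟩
  have hbase : ∀ c, A c → ∀ t ≤ 0, G c t = m s₀ := by
    intro c hc t ht
    have : clamp 0 τ t = 0 := by rw [clamp, min_eq_right (ht.trans hτ0.le), max_eq_left ht]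
    simp only [hG, this, hSinit c hc]
  set h : ℕ → ℝ := fun n => τ / (n + 1) with hh
  have hh0 : ∀ n, 0 ≤ h n := fun n => by positivity
  have happrox : ∀ n, ∃ c, A c ∧ ∀ t ≤ τ, c t = G c (t - h n) := by
    intro n
    obtain ⟨c, hc, hcf⟩ := exists_delayed_fixedPoint (hh0 n) hconst (hGshift _) hbase
      (fun _ => rfl) hcaus (n + 1)
    refine ⟨c, hc, fun t ht => hcf t (ht.trans_eq ?_)⟩
    simp only [hh]
    push_cast
    field_simp
  choose c hcA hcfix using happrox
  set B : ℕ → ℝ := fun k => Real.sqrt (C * e k) with hB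
  have hVB : ∀ n k, ∀ t ∈ Icc 0 τ, |V (c n) k t| ≤ B k := fun n k t ht =>
    Real.abs_le_sqrt (le_trans (le_add_of_nonneg_right (by positivity)) (hE _ (hcA n) k t ht))
  have hB0 : ∀ k, 0 ≤ B k := fun k => Real.sqrt_nonneg _
  have hUB : ∀ n k, ∀ t ∈ Icc 0 τ, |U (c n) k t| ≤ |a k| + B k * τ := fun n k t ht => by
    have := abs_le_add_of_abs_deriv_le (fun t ht => (hosc _ (hcA n) k t ht).1)
      (fun t ht => hVB n k t ht) (hB0 k) ht
    rwa [hU0 _ (hcA n)] at this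
  set F : Ultrafilter ℕ := hyperfilter ℕ with hF
  have hFtop : (F : Filter ℕ) ≤ atTop := Nat.hyperfilter_le_atTop
  have hUlim : ∀ k t, ∃ y, t ∈ Icc 0 τ → Tendsto (fun n => U (c n) k t) F (𝓝 y) := by
    intro k t
    by_cases ht : t ∈ Icc 0 τ
    · exact (exists_tendsto_of_bounded F fun n => hUB n k t ht).imp fun y hy _ => hy
    · exact ⟨0, fun h => absurd h ht⟩
  have hVlim : ∀ k t, ∃ y, t ∈ Icc 0 τ → Tendsto (fun n => V (c n) k t) F (𝓝 y) := by
    intro k t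
    by_cases ht : t ∈ Icc 0 τ
    · exact (exists_tendsto_of_bounded F fun n => hVB n k t ht).imp fun y hy _ => hy
    · exact ⟨0, fun h => absurd h ht⟩
  choose u hu using hUlim
  choose v hv using hVlim
  have hSlim : ∀ t ∈ Icc 0 τ, Tendsto (fun n => S (c n) t) F (𝓝 (∑' k, lam k ^ 2 * u k t ^ 2)) := by
    intro t ht
    refine tendsto_tsum_of_dominated_convergence (hab.summable_energy C)
      (fun k => ((hu k t ht).pow 2).const_mul _) (Eventually.of_forall fun n k => ?_)
    rw [Real.norm_eq_abs, abs_of_nonneg (by positivity)]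
    exact le_trans (le_add_of_nonneg_left (sq_nonneg _)) (hE _ (hcA n) k t ht)
  have hhlim : Tendsto h F (𝓝[≥] 0) := by
    refine Tendsto.mono_left (tendsto_nhdsWithin_iff.2 ⟨?_, Eventually.of_forall hh0⟩) hFtop
    simpa [hh, div_eq_mul_inv] using (tendsto_one_div_add_atTop_nhds_zero_nat (𝕜 := ℝ)).const_mul τ
  have hclim : ∀ t ∈ Icc 0 τ,
      Tendsto (fun n => c n t) F (𝓝 (m (∑' k, lam k ^ 2 * u k t ^ 2))) := by
    intro t ht
    have h1 : Tendsto (fun n => m (S (c n) t)) F (𝓝 (m (∑' k, lam k ^ 2 * u k t ^ 2))) :=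
      H.tendsto_m (hSlim t ht) (fun n => hS0 _ _) (tsum_nonneg fun k => by positivity)
    refine h1.congr_dist (squeeze_zero (fun _ => dist_nonneg) (fun n => ?_) (hwlim.comp hhlim))
    have h2 := (hGA _ (hcA n)).sub_le t (t - h n)
    rw [sub_sub_cancel, abs_of_nonneg (hh0 n), ← hcfix n t ht.2] at h2
    simpa only [hG, clamp_of_mem ht, Real.dist_eq, Function.comp_apply] using h2
  have h00 : (0 : ℝ) ∈ Icc 0 τ := ⟨le_rfl, hτ0.le⟩
  refine ⟨τ, hτ0, u, v, ⟨fun k => ?_, fun k => ?_, fun k => ?_, fun T hT => ⟨C, hC0, fun k t ht => ?_⟩⟩⟩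
  · exact tendsto_nhds_unique (hu k 0 h00) (by simp [fun n => hU0 _ (hcA n) k])
  · exact tendsto_nhds_unique (hv k 0 h00) (by simp [fun n => hV0 _ (hcA n) k])
  · exact IsOscillator.of_tendsto (A := |a k| + B k * τ) (B := B k)
      (fun n => hosc _ (hcA n) k) hwlim hwmono
      (mul_nonneg H.delta_pos.le (Real.rpow_nonneg (H.lam_nonneg k) _))
      (by have := hB0 k; positivity) (hB0 k) (fun n t => habs _ (hcA n) t)
      (fun n t r => (hcA n).sub_le t r) (fun n t ht => hUB n k t ht) (fun n t ht => hVB n k t ht)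
      hclim (hu k) (hv k)
  · have ht' : t ∈ Icc 0 τ := ⟨ht.1, ht.2.trans hT.2⟩
    exact le_of_tendsto (((hv k t ht').pow 2).add (((hu k t ht').pow 2).const_mul _))
      (Eventually.of_forall fun n => hE _ (hcA n) k t ht')

end SubcriticalSetting

namespace IsOscillator

variable {c : ℝ → ℝ} {d l : ℝ} {y v : ℝ → ℝ}

lemma union_Icc {x₀ x₁ x₂ : ℝ} (h : IsOscillator (Icc x₀ x₁) c d l y v)
    (h' : IsOscillator (Icc x₁ x₂) c d l y v) (h01 : x₀ ≤ x₁) (h12 : x₁ ≤ x₂) :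
    IsOscillator (Icc x₀ x₂) c d l y v := by
  have hun := Icc_union_Icc_eq_Icc h01 h12
  intro t ht
  rcases lt_trichotomy t x₁ with hlt | rfl | hgt
  · have hm : Icc x₀ x₁ ∈ 𝓝[Icc x₀ x₂] t := by
      filter_upwards [self_mem_nhdsWithin, nhdsWithin_le_nhds (Iio_mem_nhds hlt)] with r hr hr'
      exact ⟨hr.1, le_of_lt hr'⟩
    have := h t ⟨ht.1, hlt.le⟩
    exact ⟨this.1.mono_of_mem_nhdsWithin hm, this.2.mono_of_mem_nhdsWithin hm⟩
  · have h1 := h t ⟨h01, le_rfl⟩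
    have h2 := h' t ⟨le_rfl, h12⟩
    rw [← hun]
    exact ⟨h1.1.union h2.1, h1.2.union h2.2⟩
  · have hm : Icc x₁ x₂ ∈ 𝓝[Icc x₀ x₂] t := by
      filter_upwards [self_mem_nhdsWithin, nhdsWithin_le_nhds (Ioi_mem_nhds hgt)] with r hr hr'
      exact ⟨le_of_lt hr', hr.2⟩
    have := h' t ⟨hgt.le, ht.2⟩
    exact ⟨this.1.mono_of_mem_nhdsWithin hm, this.2.mono_of_mem_nhdsWithin hm⟩

lemma shift {τ : ℝ} (h : IsOscillator (Icc 0 τ) c d l y v) (x : ℝ) :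
    IsOscillator (Icc x (x + τ)) (fun t => c (t - x)) d l (fun t => y (t - x))
      (fun t => v (t - x)) := by
  intro t ht
  have hmaps : MapsTo (fun t : ℝ => t - x) (Icc x (x + τ)) (Icc 0 τ) := fun t ht =>
    ⟨by linarith [ht.1], by linarith [ht.2]⟩
  have hd : HasDerivWithinAt (fun t : ℝ => t - x) 1 (Icc x (x + τ)) t :=
    (hasDerivWithinAt_id t _).sub_const x
  have := h (t - x) (hmaps ht)
  exact ⟨(this.1.comp t hd hmaps).congr_deriv (mul_one _),
    (this.2.comp t hd hmaps).congr_deriv (mul_one _)⟩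

end IsOscillator

namespace IsTrajectory

variable {lam : ℕ → ℝ} {m : ℝ → ℝ} {σ δ : ℝ} {I J : Set ℝ} {a b : ℕ → ℝ} {u v u' v' : ℕ → ℝ → ℝ}

lemma mono (h : IsTrajectory lam m σ δ I a b u v) (hJ : J ⊆ I) :
    IsTrajectory lam m σ δ J a b u v :=
  ⟨h.init_fst, h.init_snd, fun k => (h.osc k).mono hJ, fun T hT => h.bound T (hJ hT)⟩

lemma congr (h : IsTrajectory lam m σ δ I a b u v) (h0 : 0 ∈ I) (hI : ∀ t ∈ I, Icc 0 t ⊆ I)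
    (hu : ∀ k, EqOn (u' k) (u k) I) (hv : ∀ k, EqOn (v' k) (v k) I) :
    IsTrajectory lam m σ δ I a b u' v' := by
  refine ⟨fun k => (hu k h0).trans (h.init_fst k), fun k => (hv k h0).trans (h.init_snd k),
    fun k => (h.osc k).congr (fun t ht => ?_) (hu k) (hv k), fun T hT => ?_⟩
  · simp only [fun k => hu k ht]
  · obtain ⟨C, hC, hb⟩ := h.bound T hT
    refine ⟨C, hC, fun k t ht => ?_⟩
    rw [hu k (hI T hT ht), hv k (hI T hT ht)]
    exact hb k t ht

lemma sq_fst_le {T C : ℝ} (h : IsTrajectory lam m σ δ (Icc 0 T) a b u v) (hC : 0 ≤ C)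
    (hb : ∀ k, ∀ t ∈ Icc 0 T,
      v k t ^ 2 + lam k ^ 2 * u k t ^ 2 ≤ C * (b k ^ 2 + lam k ^ 2 * a k ^ 2))
    (k : ℕ) {t : ℝ} (ht : t ∈ Icc 0 T) :
    u k t ^ 2 ≤ 2 * a k ^ 2 + 2 * T ^ 2 * (C * (b k ^ 2 + lam k ^ 2 * a k ^ 2)) := by
  set E : ℝ := C * (b k ^ 2 + lam k ^ 2 * a k ^ 2) with hE
  have hE0 : 0 ≤ E := by positivity
  have h1 : |u k t| ≤ |u k 0| + √E * T :=
    abs_le_add_of_abs_deriv_le (fun t ht => (h.osc k t ht).1)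
      (fun t ht => Real.abs_le_sqrt
        (le_trans (le_add_of_nonneg_right (by positivity)) (hb k t ht)))
      (Real.sqrt_nonneg _) ht
  rw [h.init_fst k] at h1
  have h2 := pow_le_pow_left₀ (abs_nonneg _) h1 2
  have h3 := sq_nonneg (|a k| - √E * T)
  have h4 : (√E * T) ^ 2 = T ^ 2 * E := by rw [mul_pow, Real.sq_sqrt hE0]; ring
  have h5 := sq_abs (a k)
  rw [sq_abs] at h2
  linarith

lemma memV {ωd : ℝ → ℝ} (hωd : IsModulus ωd) (hab : MemV lam ωd a b) {T : ℝ} (hT : 0 ≤ T)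
    (h : IsTrajectory lam m σ δ (Icc 0 T) a b u v) :
    MemV lam ωd (fun k => u k T) (fun k => v k T) := by
  have hTT : T ∈ Icc 0 T := ⟨hT, le_rfl⟩
  obtain ⟨C, hC, hb⟩ := h.bound T hTT
  have hbT := fun k => hb k T hTT
  have hsum := hab.summable_energy C
  refine ⟨?_, hab.summable_of_energy_le hbT, ?_, ?_⟩
  · exact Summable.of_nonneg_of_le (fun k => sq_nonneg _) (fun k => h.sq_fst_le hC hb k hTT)
      ((hab.1.mul_left 2).add (hsum.mul_left (2 * T ^ 2)))
  · exact Summable.of_nonneg_of_le (fun k => sq_nonneg _)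
      (fun k => le_trans (le_add_of_nonneg_right (by positivity)) (hbT k)) hsum
  · exact Summable.of_nonneg_of_le (fun k => Vsum_nonneg hωd _ _ k)
      (fun k => Vsum_le_mul hωd (hbT k)) (hab.2.2.2.mul_left C)

/-- Concatenation of trajectories. -/
lemma append {T τ : ℝ} {u₂ v₂ : ℕ → ℝ → ℝ} (hT : 0 ≤ T) (hτ : 0 ≤ τ)
    (h : IsTrajectory lam m σ δ (Icc 0 T) a b u v)
    (h₂ : IsTrajectory lam m σ δ (Icc 0 τ) (fun k => u k T) (fun k => v k T) u₂ v₂) :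
    ∃ u' v', IsTrajectory lam m σ δ (Icc 0 (T + τ)) a b u' v' ∧
      (∀ k, EqOn (u' k) (u k) (Icc 0 T)) ∧ ∀ k, EqOn (v' k) (v k) (Icc 0 T) := by
  set u' : ℕ → ℝ → ℝ := fun k t => if t ≤ T then u k t else u₂ k (t - T) with hu'
  set v' : ℕ → ℝ → ℝ := fun k t => if t ≤ T then v k t else v₂ k (t - T) with hv'
  have hu1 : ∀ k, EqOn (u' k) (u k) (Icc 0 T) := fun k t ht => if_pos ht.2
  have hv1 : ∀ k, EqOn (v' k) (v k) (Icc 0 T) := fun k t ht => if_pos ht.2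
  have hu2 : ∀ k, EqOn (u' k) (fun t => u₂ k (t - T)) (Icc T (T + τ)) := fun k t ht => by
    rcases eq_or_lt_of_le ht.1 with rfl | hlt
    · simp [hu', h₂.init_fst k]
    · simp [hu', hlt.not_ge]
  have hv2 : ∀ k, EqOn (v' k) (fun t => v₂ k (t - T)) (Icc T (T + τ)) := fun k t ht => by
    rcases eq_or_lt_of_le ht.1 with rfl | hlt
    · simp [hv', h₂.init_snd k]
    · simp [hv', hlt.not_ge]
  have h00 : (0 : ℝ) ∈ Icc 0 T := ⟨le_rfl, hT⟩
  have h' := h.congr h00 (fun t ht => Icc_subset_Icc le_rfl ht.2) hu1 hv1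
  refine ⟨u', v', ⟨h'.init_fst, h'.init_snd, fun k => ?_, fun S hS => ?_⟩, hu1, hv1⟩
  · refine (h'.osc k).union_Icc (((h₂.osc k).shift T).congr (fun t ht => ?_) (hu2 k) (hv2 k)) hT
      (by linarith)
    simp only [fun k => hu2 k ht]
  · obtain ⟨C, hC, hb⟩ := h'.bound T ⟨hT, le_rfl⟩
    obtain ⟨C₂, hC₂, hb₂⟩ := h₂.bound τ ⟨hτ, le_rfl⟩
    refine ⟨max C (C₂ * C), le_max_of_le_left hC, fun k t ht => ?_⟩
    have he : 0 ≤ b k ^ 2 + lam k ^ 2 * a k ^ 2 := by positivity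
    rcases le_total t T with htT | htT
    · exact (hb k t ⟨ht.1, htT⟩).trans (mul_le_mul_of_nonneg_right (le_max_left _ _) he)
    · have htτ : t ∈ Icc T (T + τ) := ⟨htT, ht.2.trans hS.2⟩
      have h1 := hb₂ k (t - T) ⟨by linarith, by linarith [htτ.2]⟩
      have h2 := hb k T ⟨hT, le_rfl⟩
      rw [hu1 k ⟨hT, le_rfl⟩, hv1 k ⟨hT, le_rfl⟩] at h2
      rw [hu2 k htτ, hv2 k htτ]
      refine h1.trans ((mul_le_mul_of_nonneg_left h2 hC₂).trans ?_)
      rw [← mul_assoc]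
      exact mul_le_mul_of_nonneg_right (le_max_right _ _) he

end IsTrajectory

lemma hasDerivWithinAt_Icc_of_Ico {T : ℝ} (hT : 0 < T) {f g : ℝ → ℝ}
    (hf : ∀ t ∈ Ico 0 T, HasDerivWithinAt f (g t) (Ico 0 T) t)
    (hfc : ContinuousOn f (Icc 0 T)) (hgc : ContinuousOn g (Icc 0 T)) :
    ∀ t ∈ Icc 0 T, HasDerivWithinAt f (g t) (Icc 0 T) t := by
  intro t ht
  rcases eq_or_lt_of_le ht.2 with rfl | hlt
  · have hd : ∀ x ∈ Ioo 0 t, HasDerivAt f (g x) x := fun x hx =>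
      (hf x ⟨hx.1.le, hx.2⟩).hasDerivAt (Ico_mem_nhds hx.1 hx.2)
    have hsub : Ioo 0 t ⊆ Icc 0 t := Ioo_subset_Icc_self
    have hmem : Ioo 0 t ∈ 𝓝[<] t := Ioo_mem_nhdsLT hT
    refine (hasDerivWithinAt_Iic_of_tendsto_deriv
      (fun x hx => (hd x hx).differentiableAt.differentiableWithinAt)
      ((hfc t ht).mono hsub) hmem ?_).mono Icc_subset_Iic_self
    have h1 : Tendsto g (𝓝[<] t) (𝓝 (g t)) := by
      have := (hgc t ht).mono hsub
      rwa [ContinuousWithinAt, nhdsWithin_Ioo_eq_nhdsLT hT] at this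
    refine h1.congr' ?_
    filter_upwards [hmem] with x hx
    exact (hd x hx).deriv.symm
  · refine (hf t ⟨ht.1, hlt⟩).mono_of_mem_nhdsWithin ?_
    filter_upwards [self_mem_nhdsWithin, nhdsWithin_le_nhds (Iio_mem_nhds hlt)] with r hr hr'
    exact ⟨hr.1, hr'⟩

/-- Extension of a function with bounded derivative to the closed interval. -/
lemma exists_continuous_extension {T D : ℝ} {f g : ℝ → ℝ}
    (hf : ∀ t ∈ Ico 0 T, HasDerivWithinAt f (g t) (Ico 0 T) t)
    (hg : ∀ t ∈ Ico 0 T, |g t| ≤ D) : ∃ f', Continuous f' ∧ EqOn f' f (Ico 0 T) := by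
  have hlip : LipschitzOnWith (Real.toNNReal D) f (Ico 0 T) :=
    (convex_Ico 0 T).lipschitzOnWith_of_nnnorm_hasDerivWithin_le hf fun t ht => by
      rw [← NNReal.coe_le_coe]
      exact (hg t ht).trans (Real.le_coe_toNNReal D)
  obtain ⟨f', hf', heq⟩ := hlip.extend_real
  exact ⟨f', hf'.continuous, fun t ht => (heq ht).symm⟩

namespace SubcriticalSetting

variable {lam : ℕ → ℝ} {μ₁ : ℝ} {m ωm : ℝ → ℝ} {σ δ α : ℝ} {ωd : ℝ → ℝ} {a b : ℕ → ℝ}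
  {u v : ℕ → ℝ → ℝ}

lemma continuousOn_m (H : SubcriticalSetting lam μ₁ m ωm σ δ α ωd) : ContinuousOn m (Ici 0) := by
  intro x hx
  rw [ContinuousWithinAt, tendsto_iff_dist_tendsto_zero]
  refine squeeze_zero' (Eventually.of_forall fun _ => dist_nonneg)
    (by filter_upwards [self_mem_nhdsWithin] with t ht using H.m_sub_le t x ht hx) ?_
  refine H.modulus_m.tendsto_zero.comp (tendsto_nhdsWithin_iff.2
    ⟨?_, Eventually.of_forall fun n => mem_Ici.2 (abs_nonneg _)⟩)
  have : Continuous fun t : ℝ => |t - x| := by fun_prop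
  simpa using (this.tendsto x).mono_left nhdsWithin_le_nhds

lemma m_le (H : SubcriticalSetting lam μ₁ m ωm σ δ α ωd) {s S : ℝ} (hs : 0 ≤ s) (hS : s ≤ S) :
    m s ≤ m 0 + ωm S := by
  have h1 := H.m_sub_le s 0 hs le_rfl
  rw [sub_zero, abs_of_nonneg hs] at h1
  linarith [le_abs_self (m s - m 0), H.modulus_m.mono hs hS]

/-- Trajectories with bounded interpolation norm extend to the closed time-interval. -/
lemma extend_Icc (H : SubcriticalSetting lam μ₁ m ωm σ δ α ωd) (hab : MemV lam ωd a b) {T M : ℝ}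
    (hT : 0 < T) (h : IsTrajectory lam m σ δ (Ico 0 T) a b u v)
    (hM : ∀ t ∈ Ico 0 T, ∑' k, Vsum lam ωd (fun j => u j t) (fun j => v j t) k ≤ M) :
    ∃ u' v', IsTrajectory lam m σ δ (Icc 0 T) a b u' v' ∧
      (∀ k, EqOn (u' k) (u k) (Ico 0 T)) ∧ ∀ k, EqOn (v' k) (v k) (Ico 0 T) := by
  have hωd := H.modulus_d
  have h00 : (0 : ℝ) ∈ Ico 0 T := ⟨le_rfl, hT⟩
  have hM0 : 0 ≤ M := (tsum_nonneg fun k => Vsum_nonneg hωd _ _ k).trans (hM 0 h00)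
  have hsub : ∀ t ∈ Ico 0 T, Icc 0 t ⊆ Ico 0 T := fun t ht => Icc_subset_Ico_right ht.2
  have hmem : ∀ t ∈ Ico 0 T, MemV lam ωd (fun k => u k t) (fun k => v k t) := fun t ht =>
    (h.mono (hsub t ht)).memV hωd hab ht.1
  obtain ⟨C, hC, hCb⟩ := H.exists_energy_bound hM0 T a
  set e : ℕ → ℝ := fun k => b k ^ 2 + lam k ^ 2 * a k ^ 2 with he
  have he0 : ∀ k, 0 ≤ C * e k := fun k => by positivity
  have hE : ∀ k, ∀ t ∈ Ico 0 T, v k t ^ 2 + lam k ^ 2 * u k t ^ 2 ≤ C * e k := by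
    intro k t ht
    have := hCb t ⟨ht.1, ht.2.le⟩ u v h.init_fst (fun k => (h.osc k).mono (hsub t ht))
      (fun r hr => (hmem r (hsub t ht hr)).2.1)
      (fun r hr N => ((hmem r (hsub t ht hr)).2.2.2.sum_le_tsum N
        fun k _ => Vsum_nonneg hωd _ _ k).trans (hM r (hsub t ht hr))) k t ⟨ht.1, le_rfl⟩
    rwa [h.init_fst, h.init_snd] at this
  have hvB : ∀ k, ∀ t ∈ Ico 0 T, |v k t| ≤ √(C * e k) := fun k t ht =>
    Real.abs_le_sqrt (le_trans (le_add_of_nonneg_right (by positivity)) (hE k t ht))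
  have huext : ∀ k, ∃ f, Continuous f ∧ EqOn f (u k) (Ico 0 T) := fun k =>
    exists_continuous_extension (fun t ht => (h.osc k t ht).1) (hvB k)
  choose u' hu'c hu' using huext
  have hs0 : ∀ t, 0 ≤ ∑' k, lam k ^ 2 * u k t ^ 2 := fun t => tsum_nonneg fun k => by positivity
  have hsle : ∀ t ∈ Ico 0 T, ∑' k, lam k ^ 2 * u k t ^ 2 ≤ ∑' k, C * e k := fun t ht =>
    Summable.tsum_le_tsum (fun k => le_trans (le_add_of_nonneg_left (sq_nonneg _)) (hE k t ht))
      (hmem t ht).2.1 (hab.summable_energy C)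
  have hvext : ∀ k, ∃ f, Continuous f ∧ EqOn f (v k) (Ico 0 T) := by
    intro k
    obtain ⟨R, hR⟩ := (isCompact_Icc (a := 0) (b := T)).exists_bound_of_continuousOn
      (hu'c k).continuousOn
    refine exists_continuous_extension (D := 2 * |δ * lam k ^ (2 * σ)| * √(C * e k) +
      (m 0 + ωm (∑' k, C * e k)) * lam k ^ 2 * R) (fun t ht => (h.osc k t ht).2) fun t ht => ?_
    refine (abs_sub _ _).trans ?_
    have h1 := hR t (Ico_subset_Icc_self ht)
    rw [hu' k ht] at h1
    have h2 := H.m_le (hs0 t) (hsle t ht)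
    have h3 := H.mu_pos.le.trans (H.le_m _ (hs0 t))
    rw [abs_neg, abs_mul, abs_mul 2, abs_two, abs_mul (_ * _), abs_mul (m _), abs_of_nonneg h3,
      abs_of_nonneg (sq_nonneg (lam k))]
    have h4 := hvB k t ht
    have h5 : |u k t| ≤ R := h1
    exact add_le_add (by gcongr) (mul_le_mul (mul_le_mul_of_nonneg_right h2 (sq_nonneg _)) h5
      (abs_nonneg _) (mul_nonneg (h3.trans h2) (sq_nonneg _)))
  choose v' hv'c hv' using hvext
  have hE' : ∀ k, ∀ t ∈ Icc 0 T, v' k t ^ 2 + lam k ^ 2 * u' k t ^ 2 ≤ C * e k := by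
    intro k t ht
    rw [← closure_Ico hT.ne] at ht
    have hcont : Continuous fun t => v' k t ^ 2 + lam k ^ 2 * u' k t ^ 2 := by
      have := hu'c k
      have := hv'c k
      fun_prop
    refine closure_minimal (fun r hr => ?_) (isClosed_le hcont continuous_const) ht
    simp only [mem_ofPred_eq, hu' k hr, hv' k hr]
    exact hE k r hr
  have hsc : ContinuousOn (fun t => ∑' k, lam k ^ 2 * u' k t ^ 2) (Icc 0 T) := by
    refine continuousOn_tsum (fun k => ?_) (hab.summable_energy C) fun k t ht => ?_
    · have := hu'c k
      fun_prop
    · rw [Real.norm_eq_abs, abs_of_nonneg (by positivity)]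
      exact le_trans (le_add_of_nonneg_left (sq_nonneg _)) (hE' k t ht)
  have hmc : ContinuousOn (fun t => m (∑' k, lam k ^ 2 * u' k t ^ 2)) (Icc 0 T) :=
    H.continuousOn_m.comp hsc fun t _ => mem_Ici.2 (tsum_nonneg fun k => by positivity)
  have h' := h.congr h00 hsub hu' hv'
  refine ⟨u', v', ⟨h'.init_fst, h'.init_snd, fun k t ht => ⟨?_, ?_⟩,
    fun S hS => ⟨C, hC, fun k t ht => hE' k t ⟨ht.1, ht.2.trans hS.2⟩⟩⟩, hu', hv'⟩
  · exact hasDerivWithinAt_Icc_of_Ico hT (fun t ht => (h'.osc k t ht).1) (hu'c k).continuousOn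
      (hv'c k).continuousOn t ht
  · refine hasDerivWithinAt_Icc_of_Ico hT (fun t ht => (h'.osc k t ht).2) (hv'c k).continuousOn
      ?_ t ht
    exact (continuousOn_const.mul (hv'c k).continuousOn).neg.sub
      ((hmc.mul continuousOn_const).mul (hu'c k).continuousOn)

/-- A trajectory on a closed interval extends to a larger one. -/
lemma exists_extension (H : SubcriticalSetting lam μ₁ m ωm σ δ α ωd) (hab : MemV lam ωd a b)
    {T : ℝ} (hT : 0 ≤ T) (h : IsTrajectory lam m σ δ (Icc 0 T) a b u v) :
    ∃ T' > T, ∃ u' v', IsTrajectory lam m σ δ (Icc 0 T') a b u' v' ∧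
      (∀ k, EqOn (u' k) (u k) (Icc 0 T)) ∧ ∀ k, EqOn (v' k) (v k) (Icc 0 T) := by
  obtain ⟨τ, hτ, u₂, v₂, h₂⟩ := H.exists_local (h.memV H.modulus_d hab hT)
  exact ⟨T + τ, by linarith, h.append hT hτ.le h₂⟩

end SubcriticalSetting

namespace L2Cont

variable {I : Set ℝ} {f : ℝ → ℕ → ℝ}

/-- Componentwise continuous and locally dominated curves are continuous in `ℓ²`. -/
lemma of_dominated (hc : ∀ k, ContinuousOn (fun t => f t k) I)
    (hdom : ∀ t ∈ I, ∃ g : ℕ → ℝ, Summable g ∧ ∃ U ∈ 𝓝[I] t, ∀ s ∈ U, ∀ k, f s k ^ 2 ≤ g k) :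
    L2Cont I f := by
  refine ⟨fun t ht => ?_, fun t ht ε hε => ?_⟩
  · obtain ⟨g, hg, U, hU, hle⟩ := hdom t ht
    exact Summable.of_nonneg_of_le (fun k => sq_nonneg _) (hle t (mem_of_mem_nhdsWithin ht hU)) hg
  · obtain ⟨g, hg, U, hU, hle⟩ := hdom t ht
    have hlim : Tendsto (fun s => ∑' k, (f s k - f t k) ^ 2) (𝓝[I] t) (𝓝 (∑' _ : ℕ, 0)) := by
      refine tendsto_tsum_of_dominated_convergence (hg.mul_left 4) (fun k => ?_) ?_
      · have := ((hc k t ht).tendsto.sub_const (f t k)).pow 2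
        simpa using this
      · filter_upwards [hU] with s hs k
        have h1 := hle s hs k
        have h2 := hle t (mem_of_mem_nhdsWithin ht hU) k
        rw [Real.norm_eq_abs, abs_of_nonneg (sq_nonneg _)]
        nlinarith [sq_nonneg (f s k + f t k)]
    rw [tsum_zero] at hlim
    obtain ⟨η, hη, hsub⟩ := Metric.mem_nhdsWithin_iff.1 (hlim.eventually (gt_mem_nhds hε))
    exact ⟨η, hη, fun s hs hst => hsub ⟨by rwa [Metric.mem_ball, Real.dist_eq], hs⟩⟩

lemma exists_tsum_le (h : L2Cont I f) (hI : IsCompact I) : ∃ B, ∀ t ∈ I, ∑' k, f t k ^ 2 ≤ B := by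
  refine hI.induction_on (p := fun J => ∃ B, ∀ t ∈ J, ∑' k, f t k ^ 2 ≤ B) ⟨0, by simp⟩
    (fun J J' hJ ⟨B, hB⟩ => ⟨B, fun t ht => hB t (hJ ht)⟩)
    (fun J J' ⟨B, hB⟩ ⟨B', hB'⟩ => ⟨max B B', fun t ht => ht.elim
      (fun h => (hB t h).trans (le_max_left _ _)) fun h => (hB' t h).trans (le_max_right _ _)⟩)
    fun t ht => ?_
  obtain ⟨η, hη, hle⟩ := h.2 t ht 1 one_pos
  refine ⟨Metric.ball t η ∩ I, inter_mem (mem_nhdsWithin_of_mem_nhds (Metric.ball_mem_nhds t hη))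
    self_mem_nhdsWithin, 2 * 1 + 2 * ∑' k, f t k ^ 2, ?_⟩
  rintro s ⟨hs, hsI⟩
  have h1 := hle s hsI (by rwa [Metric.mem_ball, Real.dist_eq] at hs)
  have hd : Summable fun k => (f s k - f t k) ^ 2 :=
    Summable.of_nonneg_of_le (fun k => sq_nonneg _)
      (fun k => by nlinarith [sq_nonneg (f s k + f t k)])
      (((h.1 s hsI).mul_left 2).add ((h.1 t ht).mul_left 2))
  have h2 : ∑' k, f s k ^ 2 ≤ ∑' k, (2 * (f s k - f t k) ^ 2 + 2 * f t k ^ 2) :=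
    Summable.tsum_le_tsum (fun k => by nlinarith [sq_nonneg (f s k - 2 * f t k)]) (h.1 s hsI)
      ((hd.mul_left 2).add ((h.1 t ht).mul_left 2))
  rw [(hd.mul_left 2).tsum_add ((h.1 t ht).mul_left 2), tsum_mul_left, tsum_mul_left] at h2
  linarith

end L2Cont

lemma Vsum_eq_sq_add_sq {lam : ℕ → ℝ} {ωd : ℝ → ℝ} (hωd : IsModulus ωd) (a b : ℕ → ℝ) (k : ℕ) :
    Vsum lam ωd a b k = (if 0 < lam k then lam k * a k / √(ωd (1 / lam k)) else 0) ^ 2 +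
      (if 0 < lam k then b k / √(ωd (1 / lam k)) else 0) ^ 2 := by
  unfold Vsum
  split_ifs with hk
  · have h := hωd.pos (one_div_pos.2 hk)
    rw [div_pow, div_pow, Real.sq_sqrt h.le]
    ring
  · simp

namespace IsTrajectory

variable {lam : ℕ → ℝ} {m : ℝ → ℝ} {σ δ : ℝ} {I : Set ℝ} {a b : ℕ → ℝ} {u v : ℕ → ℝ → ℝ}

lemma eqOn_derivWithin (h : IsTrajectory lam m σ δ I a b u v) (hI : UniqueDiffOn ℝ I) (k : ℕ) :
    EqOn (derivWithin (u k) I) (v k) I := fun t ht =>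
  (h.osc k t ht).1.derivWithin (hI t ht)

end IsTrajectory

namespace SubcriticalSetting

variable {lam : ℕ → ℝ} {μ₁ : ℝ} {m ωm : ℝ → ℝ} {σ δ α : ℝ} {ωd : ℝ → ℝ} {a b : ℕ → ℝ}
  {u v : ℕ → ℝ → ℝ} {I : Set ℝ}

/-- Trajectories starting in the interpolation space are regular solutions. -/
lemma isKirchhoffSol_and_VRegCurves (H : SubcriticalSetting lam μ₁ m ωm σ δ α ωd)
    (hab : MemV lam ωd a b) (h : IsTrajectory lam m σ δ I a b u v) (hI : UniqueDiffOn ℝ I)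
    (h0 : 0 ∈ I) (hIcc : ∀ t ∈ I, 0 ≤ t ∧ Icc 0 t ⊆ I)
    (hloc : ∀ t ∈ I, ∃ T ∈ I, Icc 0 T ∈ 𝓝[I] t) :
    IsKirchhoffSol lam m σ δ I a b u ∧ VRegCurves lam ωd I u := by
  have hωd := H.modulus_d
  have hder := h.eqOn_derivWithin hI
  have huc : ∀ k, ContinuousOn (u k) I := fun k => (h.osc k).continuousOn_fst
  have hvc : ∀ k, ContinuousOn (v k) I := fun k => (h.osc k).continuousOn_snd
  have hdc : ∀ k, ContinuousOn (derivWithin (u k) I) I := fun k => (hvc k).congr (hder k)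
  have hsc : ContinuousOn (fun t => ∑' k, lam k ^ 2 * u k t ^ 2) I := by
    intro t ht
    obtain ⟨T, hT, hU⟩ := hloc t ht
    obtain ⟨C, hC, hb⟩ := h.bound T hT
    have : ContinuousOn (fun t => ∑' k, lam k ^ 2 * u k t ^ 2) (Icc 0 T) := by
      refine continuousOn_tsum (fun k => ?_) (hab.summable_energy C) fun k t ht => ?_
      · have := (huc k).mono (hIcc T hT).2
        fun_prop
      · rw [Real.norm_eq_abs, abs_of_nonneg (by positivity)]
        exact le_trans (le_add_of_nonneg_left (sq_nonneg _)) (hb k t ht)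
    exact (this t (mem_of_mem_nhdsWithin ht hU)).mono_of_mem_nhdsWithin hU
  have hmc : ContinuousOn (fun t => m (∑' k, lam k ^ 2 * u k t ^ 2)) I :=
    H.continuousOn_m.comp hsc fun t _ => mem_Ici.2 (tsum_nonneg fun k => by positivity)
  have hdom : ∀ t ∈ I, ∃ T, Icc 0 T ∈ 𝓝[I] t ∧ Icc 0 T ⊆ I ∧ ∃ C, 0 ≤ C ∧
      (∀ k, ∀ s ∈ Icc 0 T, u k s ^ 2 ≤
        2 * a k ^ 2 + 2 * T ^ 2 * (C * (b k ^ 2 + lam k ^ 2 * a k ^ 2))) ∧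
      ∀ k, ∀ s ∈ Icc 0 T, derivWithin (u k) I s ^ 2 + lam k ^ 2 * u k s ^ 2 ≤
        C * (b k ^ 2 + lam k ^ 2 * a k ^ 2) := by
    intro t ht
    obtain ⟨T, hT, hU⟩ := hloc t ht
    obtain ⟨C, hC, hb⟩ := h.bound T hT
    have hsub := (hIcc T hT).2
    refine ⟨T, hU, hsub, C, hC, fun k s hs => (h.mono hsub).sq_fst_le hC hb k hs, fun k s hs => ?_⟩
    rw [hder k (hsub hs)]
    exact hb k s hs
  have hVdom : ∀ t ∈ I, ∃ g : ℕ → ℝ, Summable g ∧ ∃ U ∈ 𝓝[I] t, ∀ s ∈ U, ∀ k,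
      Vsum lam ωd (fun k => u k s) (fun k => derivWithin (u k) I s) k ≤ g k := by
    intro t ht
    obtain ⟨T, hU, hsub, C, hC, -, hb⟩ := hdom t ht
    exact ⟨_, hab.2.2.2.mul_left C, _, hU, fun s hs k => Vsum_le_mul hωd (hb k s hs)⟩
  refine ⟨⟨fun k => ?_, h.init_fst, fun k => (hder k h0).trans (h.init_snd k), fun k t ht => ?_,
    ?_, ?_, ?_⟩, fun t ht => ?_, ?_, ?_⟩
  · have hdv : ∀ t ∈ I, derivWithin (v k) I t = _ := fun t ht =>
      (h.osc k t ht).2.derivWithin (hI t ht)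
    have hv1 : ContDiffOn ℝ 1 (v k) I := by
      have := (contDiffOn_succ_iff_derivWithin (n := 0) (f := v k) hI).2
        ⟨fun t ht => (h.osc k t ht).2.differentiableWithinAt, by simp, contDiffOn_zero.2
          (((continuousOn_const.mul (hvc k)).neg.sub
            ((hmc.mul continuousOn_const).mul (huc k))).congr hdv)⟩
      simpa using this
    have := (contDiffOn_succ_iff_derivWithin (n := 1) (f := u k) hI).2
      ⟨fun t ht => (h.osc k t ht).1.differentiableWithinAt, by simp, hv1.congr (hder k)⟩
    rwa [one_add_one_eq_two] at this
  · rw [derivWithin_congr (hder k) (hder k ht), (h.osc k t ht).2.derivWithin (hI t ht), hder k ht]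
    ring
  · refine L2Cont.of_dominated huc fun t ht => ?_
    obtain ⟨T, hU, hsub, C, hC, hb, -⟩ := hdom t ht
    exact ⟨_, (hab.1.mul_left 2).add ((hab.summable_energy C).mul_left (2 * T ^ 2)), _, hU,
      fun s hs k => hb k s hs⟩
  · refine L2Cont.of_dominated (fun k => continuousOn_const.mul (huc k)) fun t ht => ?_
    obtain ⟨T, hU, hsub, C, hC, -, hb⟩ := hdom t ht
    refine ⟨_, hab.summable_energy C, _, hU, fun s hs k => ?_⟩
    rw [mul_pow]
    exact le_trans (le_add_of_nonneg_left (sq_nonneg _)) (hb k s hs)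
  · refine L2Cont.of_dominated hdc fun t ht => ?_
    obtain ⟨T, hU, hsub, C, hC, -, hb⟩ := hdom t ht
    exact ⟨_, hab.summable_energy C, _, hU, fun s hs k =>
      le_trans (le_add_of_nonneg_right (by positivity)) (hb k s hs)⟩
  · obtain ⟨g, hg, U, hU, hle⟩ := hVdom t ht
    exact Summable.of_nonneg_of_le (fun k => Vsum_nonneg hωd _ _ k)
      (hle t (mem_of_mem_nhdsWithin ht hU)) hg
  · refine L2Cont.of_dominated (fun k => ?_) fun t ht => ?_
    · split_ifs
      exacts [(continuousOn_const.mul (huc k)).div_const _, continuousOn_const]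
    · obtain ⟨g, hg, U, hU, hle⟩ := hVdom t ht
      refine ⟨g, hg, U, hU, fun s hs k => le_trans ?_ (hle s hs k)⟩
      rw [Vsum_eq_sq_add_sq hωd]
      exact le_add_of_nonneg_right (sq_nonneg _)
  · refine L2Cont.of_dominated (fun k => ?_) fun t ht => ?_
    · split_ifs
      exacts [(hdc k).div_const _, continuousOn_const]
    · obtain ⟨g, hg, U, hU, hle⟩ := hVdom t ht
      refine ⟨g, hg, U, hU, fun s hs k => le_trans ?_ (hle s hs k)⟩
      rw [Vsum_eq_sq_add_sq hωd]
      exact le_add_of_nonneg_left (sq_nonneg _)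

/-- Regular solutions on a compact interval are trajectories. -/
lemma isTrajectory_of_isKirchhoffSol (H : SubcriticalSetting lam μ₁ m ωm σ δ α ωd) {T : ℝ}
    (hT : 0 < T) (hu : IsKirchhoffSol lam m σ δ (Icc 0 T) a b u)
    (hreg : VRegCurves lam ωd (Icc 0 T) u) :
    IsTrajectory lam m σ δ (Icc 0 T) a b u (fun k => derivWithin (u k) (Icc 0 T)) := by
  have hωd := H.modulus_d
  have hI := uniqueDiffOn_Icc hT
  obtain ⟨hC2, hua, hub, heq, -, hL2, -⟩ := hu
  have hosc : ∀ k, IsOscillator (Icc 0 T) (fun t => m (∑' j, lam j ^ 2 * u j t ^ 2))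
      (δ * lam k ^ (2 * σ)) (lam k) (u k) (derivWithin (u k) (Icc 0 T)) := by
    intro k t ht
    have h2 := hC2 k
    rw [← one_add_one_eq_two, contDiffOn_succ_iff_derivWithin hI] at h2
    refine ⟨(h2.1 t ht).hasDerivWithinAt,
      ((h2.2.2.differentiableOn one_ne_zero) t ht).hasDerivWithinAt.congr_deriv ?_⟩
    have := heq k t ht
    linarith
  obtain ⟨B₁, hB₁⟩ := hreg.2.1.exists_tsum_le isCompact_Icc
  obtain ⟨B₂, hB₂⟩ := hreg.2.2.exists_tsum_le isCompact_Icc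
  have hV : ∀ t ∈ Icc 0 T, ∀ N : Finset ℕ, ∑ k ∈ N, Vsum lam ωd (fun j => u j t)
      (fun j => derivWithin (u j) (Icc 0 T) t) k ≤ B₁ + B₂ := by
    intro t ht N
    simp only [Vsum_eq_sq_add_sq hωd, Finset.sum_add_distrib]
    exact add_le_add
      (((hreg.2.1.1 t ht).sum_le_tsum N fun _ _ => sq_nonneg _).trans (hB₁ t ht))
      (((hreg.2.2.1 t ht).sum_le_tsum N fun _ _ => sq_nonneg _).trans (hB₂ t ht))
  have hB : 0 ≤ B₁ + B₂ := by simpa using hV 0 ⟨le_rfl, hT.le⟩ ∅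
  obtain ⟨C, hC, hb⟩ := H.exists_energy_bound hB T a
  refine ⟨hua, hub, hosc, fun S hS => ⟨C, hC, fun k t ht => ?_⟩⟩
  have := hb T ⟨hT.le, le_rfl⟩ u _ hua hosc
    (fun t ht => by simpa only [mul_pow] using hL2.1 t ht) hV k t ⟨ht.1, ht.2.trans hS.2⟩
  rwa [hua, hub] at this

end SubcriticalSetting

/-- The half-open time-interval `[0, T)` with a possibly infinite endpoint. -/
def timeInterval (T : EReal) : Set ℝ := {t | 0 ≤ t ∧ (t : EReal) < T}

lemma timeInterval_mono {T T' : EReal} (h : T ≤ T') : timeInterval T ⊆ timeInterval T' :=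
  fun _ ht => ⟨ht.1, ht.2.trans_le h⟩

lemma Icc_subset_timeInterval {T : EReal} {t : ℝ} (ht : t ∈ timeInterval T) :
    Icc 0 t ⊆ timeInterval T :=
  fun _ hr => ⟨hr.1, (EReal.coe_le_coe_iff.2 hr.2).trans_lt ht.2⟩

lemma timeInterval_mem_nhdsWithin {T T' : EReal} {t : ℝ} (ht : t ∈ timeInterval T) :
    timeInterval T ∈ 𝓝[timeInterval T'] t := by
  filter_upwards [self_mem_nhdsWithin, nhdsWithin_le_nhds
    ((isOpen_Iio.preimage continuous_coe_real_ereal).mem_nhds ht.2)] with r hr hr'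
  exact ⟨hr.1, hr'⟩

lemma timeInterval_coe (T : ℝ) : timeInterval T = Ico 0 T := by
  ext t
  simp [timeInterval]

lemma timeInterval_top : timeInterval ⊤ = Ici 0 := by
  ext t
  simp [timeInterval]

namespace IsTrajectory

variable {lam : ℕ → ℝ} {m : ℝ → ℝ} {σ δ : ℝ} {I : Set ℝ} {a b : ℕ → ℝ} {u v : ℕ → ℝ → ℝ}

lemma of_locally (h0 : 0 ∈ I)
    (h : ∀ t ∈ I, ∃ J ∈ 𝓝[I] t, 0 ∈ J ∧ IsTrajectory lam m σ δ J a b u v) :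
    IsTrajectory lam m σ δ I a b u v := by
  obtain ⟨J₀, -, -, hJ₀⟩ := h 0 h0
  refine ⟨hJ₀.init_fst, hJ₀.init_snd, fun k t ht => ?_, fun t ht => ?_⟩
  · obtain ⟨J, hJ, -, hJt⟩ := h t ht
    have := hJt.osc k t (mem_of_mem_nhdsWithin ht hJ)
    exact ⟨this.1.mono_of_mem_nhdsWithin hJ, this.2.mono_of_mem_nhdsWithin hJ⟩
  · obtain ⟨J, hJ, -, hJt⟩ := h t ht
    exact hJt.bound t (mem_of_mem_nhdsWithin ht hJ)

/-- Every trajectory has a maximal extension. -/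
lemma exists_maximal {S₀ : EReal} (hS₀ : 0 < S₀)
    (h : IsTrajectory lam m σ δ (timeInterval S₀) a b u v) :
    ∃ S, S₀ ≤ S ∧ ∃ u' v' : ℕ → ℝ → ℝ, IsTrajectory lam m σ δ (timeInterval S) a b u' v' ∧
      (∀ k, EqOn (u' k) (u k) (timeInterval S₀)) ∧
      ∀ S₁ u₁ v₁, S < S₁ → IsTrajectory lam m σ δ (timeInterval S₁) a b u₁ v₁ →
        (∀ k, EqOn (u₁ k) (u' k) (timeInterval S)) →
        ¬ ∀ k, EqOn (v₁ k) (v' k) (timeInterval S) := by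
  let X := {p : EReal × (ℕ → ℝ → ℝ) × (ℕ → ℝ → ℝ) // S₀ ≤ p.1 ∧
    IsTrajectory lam m σ δ (timeInterval p.1) a b p.2.1 p.2.2 ∧
    ∀ k, EqOn (p.2.1 k) (u k) (timeInterval S₀)}
  let r : X → X → Prop := fun p q => p.1.1 ≤ q.1.1 ∧
    (∀ k, EqOn (q.1.2.1 k) (p.1.2.1 k) (timeInterval p.1.1)) ∧
    ∀ k, EqOn (q.1.2.2 k) (p.1.2.2 k) (timeInterval p.1.1)
  have hrefl : ∀ p, r p p := fun p => ⟨le_rfl, fun _ _ _ => rfl, fun _ _ _ => rfl⟩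
  have htrans : ∀ {p q s : X}, r p q → r q s → r p s := fun {p q s} h1 h2 =>
    ⟨h1.1.trans h2.1,
      fun k t ht => (h2.2.1 k (timeInterval_mono h1.1 ht)).trans (h1.2.1 k ht),
      fun k t ht => (h2.2.2 k (timeInterval_mono h1.1 ht)).trans (h1.2.2 k ht)⟩
  have hchain : ∀ c : Set X, IsChain r c → c.Nonempty → ∃ ub, ∀ p ∈ c, r p ub := by
    intro c hc ⟨p₀, hp₀⟩
    set S : EReal := sSup ((fun p : X => p.1.1) '' c) with hS
    have hle : ∀ p ∈ c, p.1.1 ≤ S := fun p hp => le_sSup ⟨p, hp, rfl⟩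
    have hex : ∀ t, ∃ p ∈ c, t ∈ timeInterval S → t ∈ timeInterval p.1.1 := by
      intro t
      by_cases ht : t ∈ timeInterval S
      · obtain ⟨_, ⟨p, hp, rfl⟩, hlt⟩ := lt_sSup_iff.1 ht.2
        exact ⟨p, hp, fun _ => ⟨ht.1, hlt⟩⟩
      · exact ⟨p₀, hp₀, fun h => absurd h ht⟩
    choose P hPc hP using hex
    have hcompat : ∀ p ∈ c, ∀ q ∈ c, ∀ t ∈ timeInterval p.1.1, t ∈ timeInterval q.1.1 → ∀ k,
        p.1.2.1 k t = q.1.2.1 k t ∧ p.1.2.2 k t = q.1.2.2 k t := by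
      intro p hp q hq t htp htq k
      rcases eq_or_ne p q with rfl | hne
      · exact ⟨rfl, rfl⟩
      · rcases hc hp hq hne with h1 | h1
        · exact ⟨(h1.2.1 k htp).symm, (h1.2.2 k htp).symm⟩
        · exact ⟨h1.2.1 k htq, h1.2.2 k htq⟩
    set u' : ℕ → ℝ → ℝ := fun k t => (P t).1.2.1 k t with hu'
    set v' : ℕ → ℝ → ℝ := fun k t => (P t).1.2.2 k t with hv'
    have heq : ∀ p ∈ c, ∀ t ∈ timeInterval p.1.1, ∀ k,
        u' k t = p.1.2.1 k t ∧ v' k t = p.1.2.2 k t := fun p hp t ht k =>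
      hcompat _ (hPc t) p hp t (hP t (timeInterval_mono (hle p hp) ht)) ht k
    have h0 : ∀ p : X, (0 : ℝ) ∈ timeInterval p.1.1 := fun p =>
      ⟨le_rfl, by simpa using hS₀.trans_le p.2.1⟩
    have htraj : IsTrajectory lam m σ δ (timeInterval S) a b u' v' := by
      refine of_locally (timeInterval_mono (hle p₀ hp₀) (h0 p₀)) fun t ht =>
        ⟨timeInterval (P t).1.1, timeInterval_mem_nhdsWithin (hP t ht), h0 _,
          (P t).2.2.1.congr (h0 _) (fun s hs => Icc_subset_timeInterval hs)
            (fun k s hs => (heq _ (hPc t) s hs k).1) fun k s hs => (heq _ (hPc t) s hs k).2⟩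
    refine ⟨⟨(S, u', v'), p₀.2.1.trans (hle p₀ hp₀), htraj, fun k t ht => ?_⟩, fun p hp =>
      ⟨hle p hp, fun k t ht => (heq p hp t ht k).1, fun k t ht => (heq p hp t ht k).2⟩⟩
    exact ((heq p₀ hp₀ t (timeInterval_mono p₀.2.1 ht) k).1).trans (p₀.2.2.2 k ht)
  have : Nonempty X := ⟨⟨(S₀, u, v), le_rfl, h, fun _ _ _ => rfl⟩⟩
  obtain ⟨p, hp⟩ := exists_maximal_of_nonempty_chains_bounded hchain htrans
  refine ⟨p.1.1, p.2.1, p.1.2.1, p.1.2.2, p.2.2.1, p.2.2.2, fun S₁ u₁ v₁ hlt h₁ hu₁ hv₁ => ?_⟩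
  have := hp ⟨(S₁, u₁, v₁), p.2.1.trans hlt.le, h₁, fun k t ht =>
    (hu₁ k (timeInterval_mono p.2.1 ht)).trans (p.2.2.2 k ht)⟩ ⟨hlt.le, hu₁, hv₁⟩
  exact this.1.not_gt hlt

end IsTrajectory

namespace SubcriticalSetting

variable {lam : ℕ → ℝ} {μ₁ : ℝ} {m ωm : ℝ → ℝ} {σ δ α : ℝ} {ωd : ℝ → ℝ} {a b : ℕ → ℝ}
  {u v : ℕ → ℝ → ℝ}

/-- A trajectory whose interpolation norm stays bounded near the endpoint can be continued. -/
lemma exists_continuation (H : SubcriticalSetting lam μ₁ m ωm σ δ α ωd) (hab : MemV lam ωd a b)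
    {T M : ℝ} (hT : 0 < T) (h : IsTrajectory lam m σ δ (Ico 0 T) a b u v)
    (hM : ∀ᶠ t in 𝓝[<] T, ∑' k, Vsum lam ωd (fun j => u j t) (fun j => v j t) k ≤ M) :
    ∃ T' > T, ∃ u' v', IsTrajectory lam m σ δ (Icc 0 T') a b u' v' ∧
      (∀ k, EqOn (u' k) (u k) (Ico 0 T)) ∧ ∀ k, EqOn (v' k) (v k) (Ico 0 T) := by
  obtain ⟨r, hr, hrM⟩ := mem_nhdsLT_iff_exists_Ioo_subset.1 hM
  obtain ⟨C, hC, hb⟩ := h.bound (max r 0) ⟨le_max_right _ _, max_lt hr hT⟩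
  obtain ⟨u₁, v₁, h₁, hu₁, hv₁⟩ := H.extend_Icc (M := max M (C * ∑' k, Vsum lam ωd a b k)) hab hT h
    fun t ht => by
      rcases lt_or_ge r t with hrt | hrt
      · exact (hrM ⟨hrt, ht.2⟩ : _ ≤ M).trans (le_max_left _ _)
      · exact (Real.tsum_le_of_sum_le (fun k => Vsum_nonneg H.modulus_d _ _ k) fun N =>
          hab.sum_Vsum_le H.modulus_d hC (fun k => hb k t ⟨ht.1, hrt.trans (le_max_left _ _)⟩)
            N).trans (le_max_right _ _)
  obtain ⟨T', hT', u', v', h', hu', hv'⟩ := H.exists_extension hab hT.le h₁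
  exact ⟨T', hT', u', v', h',
    fun k t ht => (hu' k (Ico_subset_Icc_self ht)).trans (hu₁ k ht),
    fun k t ht => (hv' k (Ico_subset_Icc_self ht)).trans (hv₁ k ht)⟩

end SubcriticalSetting

/-- Subcritical dissipation, continuation alternative: every `V_{ωd}`-regular local
solution of the Kirchhoff equation can be continued to a maximal solution, defined
either globally on `[0,∞)`, or on a bounded maximal interval `[0,T*)` on which the
`V_{ωd}` seminorm blows up as `t → T*⁻`. -/
theorem continuation_alternative_subcritical
    (lam : ℕ → ℝ) (hlam : ∀ k, 0 ≤ lam k)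
    (μ₁ : ℝ) (hμ₁ : 0 < μ₁)
    (m : ℝ → ℝ) (hmlb : ∀ x : ℝ, 0 ≤ x → μ₁ ≤ m x)
    (ωm : ℝ → ℝ) (hωm : IsModulus ωm)
    (hmc : ∀ a b : ℝ, 0 ≤ a → 0 ≤ b → |m a - m b| ≤ ωm |a - b|)
    (σ δ : ℝ) (hσ0 : 0 < σ) (hσ : σ ≤ 1 / 2) (hδ : 0 < δ)
    (α : ℝ) (hα0 : 0 ≤ α) (hα1 : α < 1 / 4)
    (hlimsup : ∃ C : ℝ, ∀ᶠ x in 𝓝[>] (0:ℝ), ωm x ^ (4 * α) / x ^ (1 - 2 * σ) ≤ C)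
    (ωd : ℝ → ℝ) (hωd : IsModulus ωd) (hωd1 : ωd 1 = 1)
    (hωdle : ∀ x : ℝ, 0 ≤ x → ωd x ≤ x ^ (4 * α))
    (hωdlim : Tendsto (fun x => ωd x / x ^ (4 * α)) (𝓝[>] (0:ℝ)) (𝓝 0))
    (u0 u1 : ℕ → ℝ) (hV : MemV lam ωd u0 u1)
    (T : ℝ) (hT : 0 < T) (u : ℕ → ℝ → ℝ)
    (hu : IsKirchhoffSol lam m σ δ (Icc 0 T) u0 u1 u)
    (hureg : VRegCurves lam ωd (Icc 0 T) u) :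
    (∃ w : ℕ → ℝ → ℝ,
      IsKirchhoffSol lam m σ δ (Ici 0) u0 u1 w ∧
      VRegCurves lam ωd (Ici 0) w ∧
      ∀ k, ∀ t ∈ Icc (0:ℝ) T, w k t = u k t) ∨
    (∃ Tstar : ℝ, T < Tstar ∧ ∃ w : ℕ → ℝ → ℝ,
      IsKirchhoffSol lam m σ δ (Ico 0 Tstar) u0 u1 w ∧
      VRegCurves lam ωd (Ico 0 Tstar) w ∧
      (∀ k, ∀ t ∈ Icc (0:ℝ) T, w k t = u k t) ∧
      ∀ M : ℝ, ∃ᶠ t in 𝓝[<] Tstar,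
        M < ∑' k, Vsum lam ωd (fun j => w j t)
          (fun j => derivWithin (w j) (Ico 0 Tstar) t) k) := by
  have H : SubcriticalSetting lam μ₁ m ωm σ δ α ωd := ⟨hlam, hμ₁, hmlb, hωm, hmc, hσ0, hσ, hδ,
    hα0, hα1, hlimsup, hωd, hωd1, hωdle, hωdlim⟩
  obtain ⟨T₁, hT₁, u₁, v₁, h₁, hu₁, -⟩ := H.exists_extension hV hT.le
    (H.isTrajectory_of_isKirchhoffSol hT hu hureg)
  have hsub : timeInterval T₁ ⊆ Icc 0 T₁ := by
    rw [timeInterval_coe]; exact Ico_subset_Icc_self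
  have hTT₁ : Icc 0 T ⊆ timeInterval T₁ := by
    rw [timeInterval_coe]; exact Icc_subset_Ico_right hT₁
  obtain ⟨S, hS, w, z, hw, hwu, hmax⟩ := IsTrajectory.exists_maximal
    (EReal.coe_pos.2 (hT.trans hT₁)) (h₁.mono hsub)
  have hext : ∀ k, ∀ t ∈ Icc (0 : ℝ) T, w k t = u k t := fun k t ht =>
    (hwu k (hTT₁ ht)).trans (hu₁ k ht)
  induction S with
  | bot => exact absurd hS (by simp)
  | top =>
    left
    rw [timeInterval_top] at hw
    obtain ⟨h1, h2⟩ := H.isKirchhoffSol_and_VRegCurves hV hw (uniqueDiffOn_Ici 0) self_mem_Ici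
      (fun t ht => ⟨ht, Icc_subset_Ici_self⟩) fun t ht => ⟨t + 1, by
        have := mem_Ici.1 ht
        exact mem_Ici.2 (by linarith), by
          filter_upwards [self_mem_nhdsWithin, nhdsWithin_le_nhds
            (Iio_mem_nhds (lt_add_one t))] with r hr hr'
          exact ⟨hr, le_of_lt hr'⟩⟩
    exact ⟨w, h1, h2, hext⟩
  | coe S =>
    right
    have hTS : T < S := hT₁.trans_le (EReal.coe_le_coe_iff.1 hS)
    have hS0 : 0 < S := hT.trans hTS
    rw [timeInterval_coe] at hw hmax
    obtain ⟨h1, h2⟩ := H.isKirchhoffSol_and_VRegCurves hV hw (uniqueDiffOn_Ico 0 S) ⟨le_rfl, hS0⟩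
      (fun t ht => ⟨ht.1, Icc_subset_Ico_right ht.2⟩) fun t ht => ⟨(t + S) / 2,
        ⟨by linarith [ht.1], by linarith [ht.2]⟩, by
          filter_upwards [self_mem_nhdsWithin, nhdsWithin_le_nhds
            (Iio_mem_nhds (show t < (t + S) / 2 by linarith [ht.2]))] with r hr hr'
          exact ⟨hr.1, le_of_lt hr'⟩⟩
    refine ⟨S, hTS, w, h1, h2, hext, fun M => ?_⟩
    by_contra hM
    rw [not_frequently] at hM
    have hM' : ∀ᶠ t in 𝓝[<] S, ∑' k, Vsum lam ωd (fun j => w j t) (fun j => z j t) k ≤ M := by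
      filter_upwards [hM, Ioo_mem_nhdsLT hS0] with t ht ht'
      have := not_lt.1 ht
      simpa only [fun j => hw.eqOn_derivWithin (uniqueDiffOn_Ico 0 S) j ⟨ht'.1.le, ht'.2⟩] using this
    obtain ⟨T', hT', w', z', hw', hww', hzz'⟩ := H.exists_continuation hV hS0 hw hM'
    refine hmax T' w' z' (EReal.coe_lt_coe_iff.2 hT') ?_ hww' hzz'
    rw [timeInterval_coe]
    exact hw'.mono Ico_subset_Icc_self
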